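/- arXiv:1705.08592 — 5 statements merged into one kernel-verified Lean document; each statement's English description precedes it below -/
import Mathlib

section
/- Let G be a hypomatchable graph of order at least three, and let (H₁, …, H_m) be an odd ear decomposition of G satisfying (H1), with |V(H₁)| = 2l+1. Then for each i with 2 ≤ i ≤ m, the graph Q(i) = H_i − ⋃_{1≤j≤i−1} V(H_j) satisfies |V(Q(i))| ≤ 2l. -/
open SimpleGraph

/-- A graph is hypomatchable if deleting any vertex leaves a graph with a perfect matching. -/
def Hypomatchable {V : Type*} (G : SimpleGraph V) : Prop :=
  ∀ u : V, ∃ M : (G.induce {u}ᶜ).Subgraph, M.IsPerfectMatching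

/-- The set `⋃_{1 ≤ j ≤ i-1} V(H_j)` of vertices of the ears preceding the `i`-th ear. -/
def prevVerts {V : Type*} {G : SimpleGraph V} (H : ℕ → G.Subgraph) (i : ℕ) : Set V :=
  {v | ∃ j, 1 ≤ j ∧ j < i ∧ v ∈ (H j).verts}

/-- The vertex set of `Q(i) = H_i - ⋃_{1 ≤ j ≤ i-1} V(H_j)`. -/
def earQVerts {V : Type*} {G : SimpleGraph V} (H : ℕ → G.Subgraph) (i : ℕ) : Set V :=
  (H i).verts \ prevVerts H i

/-- `x` is an endvertex of the subgraph `K` (a path): a vertex of `K` of degree one. -/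
def IsEndvertex {V : Type*} {G : SimpleGraph V} (K : G.Subgraph) (x : V) : Prop :=
  x ∈ K.verts ∧ Nat.card (K.neighborSet x) = 1

/-- `(H 1, …, H m)` is an odd ear decomposition of `G`: a sequence of pairwise edge-disjoint
subgraphs such that (E1) their vertex sets cover `V(G)`; (E2) each `H i` has an odd number of
edges, at least 3; (E3) `H 1` is a cycle; (E4) for `2 ≤ i ≤ m`, either `H i` is a path and a
vertex of `H i` lies in `⋃_{1 ≤ j ≤ i-1} V(H_j)` exactly when it is an endvertex of `H i`, or
`H i` is a cycle meeting `⋃_{1 ≤ j ≤ i-1} V(H_j)` in exactly one vertex. -/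
def IsOddEarDecomp {V : Type*} (G : SimpleGraph V) (m : ℕ) (H : ℕ → G.Subgraph) : Prop :=
  1 ≤ m ∧
  (∀ i j, 1 ≤ i → i ≤ m → 1 ≤ j → j ≤ m → i ≠ j →
    Disjoint (H i).edgeSet (H j).edgeSet) ∧
  (∀ v : V, ∃ i, 1 ≤ i ∧ i ≤ m ∧ v ∈ (H i).verts) ∧
  (∀ i, 1 ≤ i → i ≤ m → Odd (Nat.card (H i).edgeSet) ∧ 3 ≤ Nat.card (H i).edgeSet) ∧
  (∃ n, Nonempty ((H 1).coe ≃g cycleGraph n)) ∧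
  (∀ i, 2 ≤ i → i ≤ m →
    ((∃ n, Nonempty ((H i).coe ≃g pathGraph n)) ∧
      ∀ x ∈ (H i).verts, (x ∈ prevVerts H i ↔ IsEndvertex (H i) x)) ∨
    ((∃ n, Nonempty ((H i).coe ≃g cycleGraph n)) ∧
      Nat.card ((H i).verts ∩ prevVerts H i : Set V) = 1))

/-- The sequence `(|V(H 1)|, …, |V(H m)|)` of orders of the ears. -/
noncomputable def earOrders {V : Type*} {G : SimpleGraph V} (m : ℕ) (H : ℕ → G.Subgraph) : List ℕ :=
  (List.range m).map (fun i => Nat.card (H (i + 1)).verts)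

/-- Condition (H1): `(H 1, …, H m)` is an odd ear decomposition of `G` whose sequence of
orders `(|V(H 1)|, …, |V(H m)|)` is lexicographically as large as possible among all odd ear
decompositions of `G`. -/
def IsMaxOddEarDecomp {V : Type*} (G : SimpleGraph V) (m : ℕ) (H : ℕ → G.Subgraph) : Prop :=
  IsOddEarDecomp G m H ∧
  ∀ (m' : ℕ) (H' : ℕ → G.Subgraph), IsOddEarDecomp G m' H' →
    ¬ List.Lex (· < ·) (earOrders m H) (earOrders m' H')


section PerfectlyMatchable

variable {V : Type*} {G : SimpleGraph V}

/-- `T` is the vertex set of a matching of `G`, given as an adjacent-vertex involution of `T`. -/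
def PerfectlyMatchable (G : SimpleGraph V) (T : Set V) : Prop :=
  ∃ f : V → V, ∀ v ∈ T, f v ∈ T ∧ f (f v) = v ∧ G.Adj v (f v)

/-- Deleting any vertex of `S` leaves a perfectly matchable set. -/
def FactorCritical (G : SimpleGraph V) (S : Set V) : Prop :=
  ∀ a ∈ S, PerfectlyMatchable G (S \ {a})

/-- The sequence `w 0, …, w (2 * t + 1)` is an odd ear attached to `S`; its two ends may agree. -/
structure IsOddEar (G : SimpleGraph V) (S : Set V) (t : ℕ) (w : ℕ → V) : Prop where
  first_mem : w 0 ∈ S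
  last_mem : w (2 * t + 1) ∈ S
  adj : ∀ k ≤ 2 * t, G.Adj (w k) (w (k + 1))
  injOn : Set.InjOn w (Set.Icc 1 (2 * t))
  notMem : ∀ k ∈ Set.Icc 1 (2 * t), w k ∉ S

lemma perfectlyMatchable_empty : PerfectlyMatchable G ∅ :=
  ⟨id, fun _ h => h.elim⟩

lemma PerfectlyMatchable.union {S T : Set V} (hS : PerfectlyMatchable G S)
    (hT : PerfectlyMatchable G T) (hST : Disjoint S T) : PerfectlyMatchable G (S ∪ T) := by
  classical
  obtain ⟨f, hf⟩ := hS
  obtain ⟨g, hg⟩ := hT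
  refine ⟨fun v => if v ∈ S then f v else g v, ?_⟩
  rintro v (hv | hv)
  · obtain ⟨h₁, h₂, h₃⟩ := hf v hv
    simp [hv, h₁, h₂, h₃]
  · obtain ⟨h₁, h₂, h₃⟩ := hg v hv
    have hv' : v ∉ S := fun h => hST.notMem_of_mem_left h hv
    have hv'' : g v ∉ S := fun h => hST.notMem_of_mem_left h h₁
    simp [hv', hv'', h₁, h₂, h₃]

lemma perfectlyMatchable_pair {x y : V} (h : G.Adj x y) : PerfectlyMatchable G {x, y} := by
  classical
  refine ⟨Equiv.swap x y, ?_⟩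
  rintro v (rfl | rfl)
  · simp [h]
  · simp [h.symm]

lemma perfectlyMatchable_image_Ico {w : ℕ → V} (p n : ℕ)
    (hadj : ∀ k, p ≤ k → k + 1 < p + 2 * n → G.Adj (w k) (w (k + 1)))
    (hinj : Set.InjOn w (Set.Ico p (p + 2 * n))) :
    PerfectlyMatchable G (w '' Set.Ico p (p + 2 * n)) := by
  induction n with
  | zero => simpa using perfectlyMatchable_empty
  | succ n ih =>
    have hsplit : Set.Ico p (p + 2 * (n + 1)) =
        Set.Ico p (p + 2 * n) ∪ {p + 2 * n, p + 2 * n + 1} := by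
      ext k
      simp only [Set.mem_Ico, Set.mem_union, Set.mem_insert_iff, Set.mem_singleton_iff]
      lia
    have hdisj : Disjoint (Set.Ico p (p + 2 * n)) {p + 2 * n, p + 2 * n + 1} := by
      rw [Set.disjoint_left]
      intro k
      simp only [Set.mem_Ico, Set.mem_insert_iff, Set.mem_singleton_iff]
      lia
    rw [hsplit] at hinj ⊢
    have hd : Disjoint (w '' Set.Ico p (p + 2 * n)) (w '' {p + 2 * n, p + 2 * n + 1}) := by
      rw [Set.disjoint_left]
      rintro _ ⟨i, hi, rfl⟩ ⟨j, hj, hij⟩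
      obtain rfl := hinj (Or.inr hj) (Or.inl hi) hij
      exact Set.disjoint_left.1 hdisj hi hj
    rw [Set.image_union]
    refine (ih (fun k h₁ h₂ => hadj k h₁ (by lia)) (hinj.mono Set.subset_union_left)).union ?_ hd
    rw [Set.image_pair]
    exact perfectlyMatchable_pair (hadj _ (by lia) (by lia))

namespace IsOddEar

variable {S : Set V} {t : ℕ} {w : ℕ → V}

lemma reverse (h : IsOddEar G S t w) : IsOddEar G S t (fun k => w (2 * t + 1 - k)) where
  first_mem := h.last_mem
  last_mem := by simpa using h.first_mem
  adj k hk := by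
    have := (h.adj (2 * t - k) (by lia)).symm
    rwa [show 2 * t - k + 1 = 2 * t + 1 - k by lia,
      show 2 * t - k = 2 * t + 1 - (k + 1) by lia] at this
  injOn i hi j hj hij := by
    simp only [Set.mem_Icc] at hi hj
    have := h.injOn (x₁ := 2 * t + 1 - i) (x₂ := 2 * t + 1 - j) ⟨by lia, by lia⟩
      ⟨by lia, by lia⟩ hij
    lia
  notMem k hk := h.notMem _ (by simp only [Set.mem_Icc] at hk ⊢; lia)

lemma image_reverse (t : ℕ) (w : ℕ → V) :
    (fun k => w (2 * t + 1 - k)) '' Set.Icc 1 (2 * t) = w '' Set.Icc 1 (2 * t) := by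
  ext v
  constructor
  · rintro ⟨k, hk, rfl⟩
    exact ⟨2 * t + 1 - k, by simp only [Set.mem_Icc] at hk ⊢; lia, rfl⟩
  · rintro ⟨k, hk, rfl⟩
    simp only [Set.mem_Icc] at hk
    refine ⟨2 * t + 1 - k, by simp only [Set.mem_Icc]; lia, ?_⟩
    simp only
    congr 1
    lia

lemma disjoint_interior (h : IsOddEar G S t w) : Disjoint S (w '' Set.Icc 1 (2 * t)) := by
  rw [Set.disjoint_right]
  rintro _ ⟨k, hk, rfl⟩
  exact h.notMem k hk

lemma perfectlyMatchable_interior (h : IsOddEar G S t w) :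
    PerfectlyMatchable G (w '' Set.Icc 1 (2 * t)) := by
  have hI : Set.Icc 1 (2 * t) = Set.Ico 1 (1 + 2 * t) := by
    ext k
    simp only [Set.mem_Icc, Set.mem_Ico]
    lia
  have hinj := h.injOn
  rw [hI] at hinj ⊢
  exact perfectlyMatchable_image_Ico 1 t (fun k _ h₂ => h.adj k (by lia)) hinj

lemma injOn_Icc_succ (h : IsOddEar G S t w) : Set.InjOn w (Set.Icc 1 (2 * t + 1)) := by
  have hne : ∀ k, 1 ≤ k → k ≤ 2 * t → w k ≠ w (2 * t + 1) := fun k h₁ h₂ he =>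
    h.notMem k ⟨h₁, h₂⟩ (he ▸ h.last_mem)
  intro i hi j hj hij
  simp only [Set.mem_Icc] at hi hj
  by_contra hij'
  rcases Nat.lt_or_ge (2 * t) i with hi' | hi'
  · obtain rfl : i = 2 * t + 1 := by lia
    exact hne j hj.1 (by lia) hij.symm
  rcases Nat.lt_or_ge (2 * t) j with hj' | hj'
  · obtain rfl : j = 2 * t + 1 := by lia
    exact hne i hi.1 (by lia) hij
  exact hij' (h.injOn ⟨hi.1, hi'⟩ ⟨hj.1, hj'⟩ hij)

lemma perfectlyMatchable_diff_odd (h : IsOddEar G S t w) (hS : FactorCritical G S) {u : ℕ}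
    (hu : u < t) :
    PerfectlyMatchable G ((S ∪ w '' Set.Icc 1 (2 * t)) \ {w (2 * u + 1)}) := by
  have hinj := h.injOn_Icc_succ
  have h₁ : PerfectlyMatchable G (w '' Set.Ico 1 (1 + 2 * u)) :=
    perfectlyMatchable_image_Ico 1 u (fun k _ h₂ => h.adj k (by lia))
      (h.injOn.mono fun k hk => by simp only [Set.mem_Icc, Set.mem_Ico] at hk ⊢; lia)
  have h₂ : PerfectlyMatchable G
      (w '' Set.Ico (2 * u + 2) (2 * u + 2 + 2 * (t - u))) :=
    perfectlyMatchable_image_Ico (2 * u + 2) (t - u) (fun k _ h₂ => h.adj k (by lia))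
      (hinj.mono fun k hk => by simp only [Set.mem_Icc, Set.mem_Ico] at hk ⊢; lia)
  have hd : Disjoint (w '' Set.Ico 1 (1 + 2 * u))
      (w '' Set.Ico (2 * u + 2) (2 * u + 2 + 2 * (t - u))) := by
    rw [Set.disjoint_left]
    rintro _ ⟨i, hi, rfl⟩ ⟨j, hj, hij⟩
    simp only [Set.mem_Ico] at hi hj
    have := hinj (x₁ := j) (x₂ := i) ⟨by lia, by lia⟩ ⟨by lia, by lia⟩ hij
    lia
  have h₁₂ := h₁.union h₂ hd
  rw [← Set.image_union] at h₁₂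
  have hd' : Disjoint (S \ {w (2 * t + 1)})
      (w '' (Set.Ico 1 (1 + 2 * u) ∪ Set.Ico (2 * u + 2) (2 * u + 2 + 2 * (t - u)))) := by
    rw [Set.disjoint_left]
    rintro _ ⟨hvS, hv⟩ ⟨i, hi, rfl⟩
    simp only [Set.mem_Ico, Set.mem_union] at hi
    rcases eq_or_ne i (2 * t + 1) with rfl | hi'
    · exact hv rfl
    · exact h.notMem i ⟨by lia, by lia⟩ hvS
  convert (hS _ h.last_mem).union h₁₂ hd' using 1
  ext v
  simp only [Set.mem_sdiff, Set.mem_union, Set.mem_image, Set.mem_singleton_iff, Set.mem_Icc,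
    Set.mem_Ico]
  constructor
  · rintro ⟨hv | ⟨k, hk, rfl⟩, hne⟩
    · by_cases hv' : v = w (2 * t + 1)
      · exact Or.inr ⟨2 * t + 1, by lia, hv'.symm⟩
      · exact Or.inl ⟨hv, hv'⟩
    · have : k ≠ 2 * u + 1 := fun hk' => hne (by rw [hk'])
      exact Or.inr ⟨k, by lia, rfl⟩
  · rintro (⟨hv, -⟩ | ⟨k, hk, rfl⟩)
    · exact ⟨Or.inl hv, fun he => h.notMem (2 * u + 1) ⟨by lia, by lia⟩ (he ▸ hv)⟩
    · refine ⟨?_, fun he => ?_⟩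
      · rcases eq_or_ne k (2 * t + 1) with rfl | hk'
        · exact Or.inl h.last_mem
        · exact Or.inr ⟨k, by lia, rfl⟩
      · have := hinj (x₁ := k) (x₂ := 2 * u + 1) ⟨by lia, by lia⟩ ⟨by lia, by lia⟩ he
        lia

lemma factorCritical_union (h : IsOddEar G S t w) (hS : FactorCritical G S) :
    FactorCritical G (S ∪ w '' Set.Icc 1 (2 * t)) := by
  rintro a (ha | ⟨s, hs, rfl⟩)
  · have hd := h.disjoint_interior
    have ha' : a ∉ w '' Set.Icc 1 (2 * t) := hd.notMem_of_mem_left ha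
    rw [Set.union_sdiff_distrib, Set.sdiff_singleton_eq_self ha']
    exact (hS a ha).union h.perfectlyMatchable_interior (hd.mono_left Set.sdiff_subset)
  · simp only [Set.mem_Icc] at hs
    rcases Nat.even_or_odd' s with ⟨u, rfl | rfl⟩
    · have := h.reverse.perfectlyMatchable_diff_odd hS (u := t - u) (by lia)
      rwa [image_reverse, show 2 * t + 1 - (2 * (t - u) + 1) = 2 * u by lia] at this
    · exact h.perfectlyMatchable_diff_odd hS (by lia)

end IsOddEar

lemma factorCritical_singleton (b : V) : FactorCritical G {b} := by
  rintro a rfl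
  simpa using perfectlyMatchable_empty

lemma exists_alternating_sequence [Finite V] {M N : V → V} (hM : M.Involutive)
    (hN : N.Involutive) {P S : Set V} (hMP : Set.MapsTo M P P) (hNP : Set.MapsTo N P P)
    (hMS : Set.MapsTo M S S) {r y : V} (hr : r ∈ S) (hyP : y ∈ P) (hyS : y ∉ S)
    (hMr : ∀ v ∈ P, M v = v → v = r) (hNy : ∀ v ∈ P, N v = v ↔ v = y) :
    ∃ (k : ℕ) (w : ℕ → V), 1 ≤ k ∧ w 0 = y ∧ w (2 * k) ∈ S ∧ (∀ j, w j ∈ P) ∧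
      (∀ j < 2 * k, w j ∉ S) ∧ Set.InjOn w (Set.Iio (2 * k)) ∧
      (∀ j < k, w (2 * j + 1) = M (w (2 * j))) ∧
      (∀ j < k, w (2 * j + 2) = N (w (2 * j + 1))) := by
  classical
  set f : V → V := N ∘ M with hf
  have hfinj : f.Injective := hN.injective.comp hM.injective
  have hfP : ∀ k, f^[k] y ∈ P := fun k => Set.MapsTo.iterate (hNP.comp hMP) k hyP
  set p := f.minimalPeriod y with hp
  have hp0 : 0 < p := Function.minimalPeriod_pos_of_mem_periodicPts (hfinj.mem_periodicPts y)
  have hpy : f^[p] y = y := Function.iterate_minimalPeriod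
  have hNf : ∀ k ≤ p, N (f^[k] y) = f^[p - k] y := by
    intro k
    induction k with
    | zero => simpa [hpy] using (hNy y hyP).2 rfl
    | succ k ih =>
      intro hk
      have h₁ := ih (by lia)
      rw [show p - k = (p - (k + 1)) + 1 by lia, Function.iterate_succ_apply'] at h₁
      rw [Function.iterate_succ_apply', hf, Function.comp_apply, hN, ← hf]
      have h₂ : f^[k] y = M (f^[p - (k + 1)] y) := hN.injective h₁
      rw [h₂, hM]
  have hMf : ∀ k < p, M (f^[k] y) = f^[p - 1 - k] y := by
    intro k hk
    have := hNf (k + 1) hk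
    rw [Function.iterate_succ_apply', hf, Function.comp_apply, hN, ← hf] at this
    rw [this, show p - (k + 1) = p - 1 - k by lia]
  have hinj : Set.InjOn (fun k => f^[k] y) (Set.Iio p) :=
    Function.iterate_injOn_Iio_minimalPeriod
  have hodd : ∃ t, p = 2 * t + 1 := by
    rcases Nat.even_or_odd' p with ⟨t, ht | ht⟩
    · have h₁ := hNf t (by lia)
      rw [show p - t = t by lia, hNy _ (hfP t)] at h₁
      have := hinj (x₁ := t) (x₂ := 0) (by simp; lia) (by simpa using hp0) h₁
      lia
    · exact ⟨t, ht⟩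
  obtain ⟨t, ht⟩ := hodd
  have htS : f^[t] y ∈ S := by
    have h₁ := hMf t (by lia)
    rw [show p - 1 - t = t by lia] at h₁
    rwa [hMr _ (hfP t) h₁]
  have hex : ∃ k, f^[k] y ∈ S := ⟨t, htS⟩
  set k := Nat.find hex with hk
  have hkt : k ≤ t := Nat.find_min' hex htS
  have hkS : f^[k] y ∈ S := Nat.find_spec hex
  have hk0 : 1 ≤ k := by
    by_contra h
    rw [show k = 0 by lia] at hkS
    exact hyS hkS
  have hmin : ∀ j < k, f^[j] y ∉ S := fun j hj => Nat.find_min hex hj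
  have hw₀ : ∀ j, (fun n => f^[if n % 2 = 0 then n / 2 else p - 1 - n / 2] y) (2 * j) =
      f^[j] y := fun j => by simp
  have hw₁ : ∀ j < p, (fun n => f^[if n % 2 = 0 then n / 2 else p - 1 - n / 2] y) (2 * j + 1) =
      M (f^[j] y) := fun j hj => by
    rw [hMf j hj]
    simp only [show (2 * j + 1) % 2 ≠ 0 by lia, if_false, show (2 * j + 1) / 2 = j by lia]
  refine ⟨k, fun n => f^[if n % 2 = 0 then n / 2 else p - 1 - n / 2] y, hk0, rfl, ?_,
    fun j => hfP _, ?_, ?_, ?_, ?_⟩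
  · rwa [hw₀]
  · intro j hj
    rcases Nat.even_or_odd' j with ⟨u, rfl | rfl⟩
    · rw [hw₀]
      exact hmin u (by lia)
    · rw [hw₁ u (by lia)]
      intro hS
      have := hMS hS
      rw [hM] at this
      exact hmin u (by lia) this
  · intro i hi j hj hij
    simp only [Set.mem_Iio] at hi hj
    have := hinj (x₁ := if i % 2 = 0 then i / 2 else p - 1 - i / 2)
      (x₂ := if j % 2 = 0 then j / 2 else p - 1 - j / 2)
      (by simp only [Set.mem_Iio]; split_ifs <;> lia)
      (by simp only [Set.mem_Iio]; split_ifs <;> lia) hij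
    split_ifs at this <;> lia
  · intro j hj
    rw [hw₀, hw₁ j (by lia)]
  · intro j hj
    rw [show 2 * j + 2 = 2 * (j + 1) by lia, hw₀, hw₁ j (by lia), Function.iterate_succ_apply', hf,
      Function.comp_apply]

lemma exists_alternating_path [Finite V] {P S : Set V} {r y : V} (hSP : S ⊆ P) (hr : r ∈ S)
    (hSr : PerfectlyMatchable G (S \ {r})) (hPS : PerfectlyMatchable G (P \ S)) (hyP : y ∈ P)
    (hyS : y ∉ S) (hPy : PerfectlyMatchable G (P \ {y})) :
    ∃ (k : ℕ) (w : ℕ → V), 1 ≤ k ∧ w 0 = y ∧ w (2 * k) ∈ S ∧ (∀ j < 2 * k, w j ∈ P \ S) ∧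
      Set.InjOn w (Set.Iio (2 * k)) ∧ (∀ j < 2 * k, G.Adj (w j) (w (j + 1))) ∧
      PerfectlyMatchable G (P \ (S ∪ w '' Set.Iio (2 * k))) := by
  classical
  obtain ⟨f, hf⟩ := hSr
  obtain ⟨g, hg⟩ := hPS
  obtain ⟨h, hh⟩ := hPy
  set M : V → V := fun v => if v ∈ S \ {r} then f v else if v ∈ P \ S then g v else v with hMdef
  set N : V → V := fun v => if v ∈ P \ {y} then h v else v with hNdef
  have hMf : ∀ v ∈ S \ {r}, M v = f v := fun v hv => by simp only [hMdef, if_pos hv]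
  have hMg : ∀ v ∈ P \ S, M v = g v := fun v hv => by
    simp only [hMdef, if_pos hv]
    exact if_neg fun h' => hv.2 h'.1
  have hMo : ∀ v, v ∉ S \ {r} → v ∉ P \ S → M v = v := fun v h₁ h₂ => by
    simp only [hMdef, if_neg h₁, if_neg h₂]
  have hNh : ∀ v ∈ P \ {y}, N v = h v := fun v hv => by simp only [hNdef, if_pos hv]
  have hNo : ∀ v, v ∉ P \ {y} → N v = v := fun v hv => by simp only [hNdef, if_neg hv]
  have hM : M.Involutive := by
    intro v
    by_cases h₁ : v ∈ S \ {r}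
    · rw [hMf v h₁, hMf _ (hf v h₁).1, (hf v h₁).2.1]
    by_cases h₂ : v ∈ P \ S
    · rw [hMg v h₂, hMg _ (hg v h₂).1, (hg v h₂).2.1]
    · rw [hMo v h₁ h₂, hMo v h₁ h₂]
  have hN : N.Involutive := by
    intro v
    by_cases h₁ : v ∈ P \ {y}
    · rw [hNh v h₁, hNh _ (hh v h₁).1, (hh v h₁).2.1]
    · rw [hNo v h₁, hNo v h₁]
  have hMS : Set.MapsTo M S S := by
    intro v hv
    by_cases h₁ : v ∈ S \ {r}
    · rw [hMf v h₁]
      exact (hf v h₁).1.1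
    · rwa [hMo v h₁ (fun h₂ => h₂.2 hv)]
  have hMP : Set.MapsTo M P P := by
    intro v hv
    by_cases h₁ : v ∈ S
    · exact hSP (hMS h₁)
    · rw [hMg v ⟨hv, h₁⟩]
      exact (hg v ⟨hv, h₁⟩).1.1
  have hNP : Set.MapsTo N P P := by
    intro v hv
    by_cases h₁ : v ∈ P \ {y}
    · rw [hNh v h₁]
      exact (hh v h₁).1.1
    · rwa [hNo v h₁]
  have hMr : ∀ v ∈ P, M v = v → v = r := by
    intro v hv hMv
    by_contra hne
    by_cases h₁ : v ∈ S
    · rw [hMf v ⟨h₁, hne⟩] at hMv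
      exact (hf v ⟨h₁, hne⟩).2.2.ne hMv.symm
    · rw [hMg v ⟨hv, h₁⟩] at hMv
      exact (hg v ⟨hv, h₁⟩).2.2.ne hMv.symm
  have hNy : ∀ v ∈ P, N v = v ↔ v = y := by
    refine fun v hv => ⟨fun hNv => ?_, fun hv' => hNo v fun h₁ => h₁.2 hv'⟩
    by_contra hne
    rw [hNh v ⟨hv, hne⟩] at hNv
    exact (hh v ⟨hv, hne⟩).2.2.ne hNv.symm
  obtain ⟨k, w, hk, hw0, hwS, hwP, hwnS, hinj, hwM, hwN⟩ :=
    exists_alternating_sequence hM hN hMP hNP hMS hr hyP hyS hMr hNy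
  have hwPS : ∀ j < 2 * k, w j ∈ P \ S := fun j hj => ⟨hwP j, hwnS j hj⟩
  refine ⟨k, w, hk, hw0, hwS, hwPS, hinj, ?_, g, ?_⟩
  · intro j hj
    rcases Nat.even_or_odd' j with ⟨u, rfl | rfl⟩
    · rw [hwM u (by lia), hMg _ (hwPS _ hj)]
      exact (hg _ (hwPS _ hj)).2.2
    · have hmem : w (2 * u + 1) ∈ P \ {y} := by
        refine ⟨hwP _, fun he => ?_⟩
        have := hinj (x₁ := 2 * u + 1) (x₂ := 0) hj (by simp; lia) (he.trans hw0.symm)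
        lia
      rw [hwN u (by lia), hNh _ hmem]
      exact (hh _ hmem).2.2
  · rintro v ⟨hvP, hv⟩
    have hvS : v ∉ S := fun h' => hv (Or.inl h')
    obtain ⟨h₁, h₂, h₃⟩ := hg v ⟨hvP, hvS⟩
    refine ⟨⟨h₁.1, ?_⟩, h₂, h₃⟩
    rintro (h' | ⟨j, hj, hgj⟩)
    · exact h₁.2 h'
    · simp only [Set.mem_Iio] at hj
      apply hv
      right
      have hvw : v = M (w j) := by rw [hMg _ (hwPS j hj), hgj, h₂]
      rcases Nat.even_or_odd' j with ⟨u, rfl | rfl⟩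
      · exact ⟨2 * u + 1, by simp only [Set.mem_Iio]; lia, by rw [hvw, hwM u (by lia)]⟩
      · refine ⟨2 * u, by simp only [Set.mem_Iio]; lia, ?_⟩
        rw [hvw, hwM u (by lia), hM]

lemma exists_oddEar [Finite V] {S : Set V} (hG : FactorCritical G Set.univ) (hne : S.Nonempty)
    (hS : FactorCritical G S) (hSc : PerfectlyMatchable G Sᶜ) (hSu : S ≠ Set.univ) :
    ∃ (t : ℕ) (w : ℕ → V), 1 ≤ t ∧ IsOddEar G S t w ∧
      PerfectlyMatchable G (S ∪ w '' Set.Icc 1 (2 * t))ᶜ := by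
  obtain ⟨r, hr⟩ := hne
  obtain ⟨y₀, hy₀⟩ := (Set.ne_univ_iff_exists_notMem S).1 hSu
  rw [Set.compl_eq_univ_sdiff] at hSc
  have key : ∀ y ∉ S, _ := fun y hy => exists_alternating_path (Set.subset_univ S) hr (hS r hr)
    hSc (Set.mem_univ y) hy (hG y (Set.mem_univ y))
  obtain ⟨k₀, w₀, hk₀, -, hend, hout, -, hadj₀, -⟩ := key y₀ hy₀
  obtain ⟨k, w, hk, hw0, hwS, hwn, hinj, hadj, hrest⟩ :=
    key (w₀ (2 * k₀ - 1)) (hout _ (by lia)).2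
  have himg : (fun n : ℕ => if n = 0 then w₀ (2 * k₀) else w (n - 1)) '' Set.Icc 1 (2 * k) =
      w '' Set.Iio (2 * k) := by
    ext v
    constructor
    · rintro ⟨n, hn, rfl⟩
      simp only [Set.mem_Icc] at hn
      exact ⟨n - 1, by simp only [Set.mem_Iio]; lia, by simp [show n ≠ 0 by lia]⟩
    · rintro ⟨n, hn, rfl⟩
      simp only [Set.mem_Iio] at hn
      exact ⟨n + 1, by simp only [Set.mem_Icc]; lia, by simp⟩
  refine ⟨k, fun n => if n = 0 then w₀ (2 * k₀) else w (n - 1), hk, ⟨?_, ?_, ?_, ?_, ?_⟩, ?_⟩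
  · simpa using hend
  · simpa using hwS
  · intro n hn
    rcases Nat.eq_zero_or_pos n with rfl | hn'
    · have := (hadj₀ (2 * k₀ - 1) (by lia)).symm
      rw [show 2 * k₀ - 1 + 1 = 2 * k₀ by lia, ← hw0] at this
      simpa using this
    · have := hadj (n - 1) (by lia)
      rw [show n - 1 + 1 = n by lia] at this
      simpa [show n ≠ 0 by lia] using this
  · intro i hi j hj hij
    simp only [Set.mem_Icc] at hi hj
    simp only [show i ≠ 0 by lia, show j ≠ 0 by lia, if_false] at hij
    have := hinj (x₁ := i - 1) (x₂ := j - 1) (by simp only [Set.mem_Iio]; lia)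
      (by simp only [Set.mem_Iio]; lia) hij
    lia
  · intro j hj
    simp only [Set.mem_Icc] at hj
    simp only [show j ≠ 0 by lia, if_false]
    exact (hwn _ (by lia)).2
  · rwa [himg, Set.compl_eq_univ_sdiff]

/-- An odd ear of a factor-critical set `P` closes up, inside `P`, to an odd cycle through its last
vertex that is at least as long, and whose complement in `P` together with the ear is perfectly
matchable. -/
lemma IsOddEar.exists_closed [Finite V] {P : Set V} {t : ℕ} {w : ℕ → V} (h : IsOddEar G P t w)
    (hP : FactorCritical G P) :
    ∃ (b : V) (s : ℕ) (c : ℕ → V), t ≤ s ∧ IsOddEar G {b} s c ∧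
      {b} ∪ c '' Set.Icc 1 (2 * s) ⊆ P ∪ w '' Set.Icc 1 (2 * t) ∧
      PerfectlyMatchable G
        ((P ∪ w '' Set.Icc 1 (2 * t)) \ ({b} ∪ c '' Set.Icc 1 (2 * s))) := by
  have hd := h.disjoint_interior
  by_cases hab : w 0 = w (2 * t + 1)
  · refine ⟨w (2 * t + 1), t, w, le_rfl,
      ⟨hab, rfl, h.adj, h.injOn, fun k hk he => h.notMem k hk ?_⟩, ?_, ?_⟩
    · rw [he]
      exact h.last_mem
    · exact Set.union_subset_union_left _ (Set.singleton_subset_iff.2 h.last_mem)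
    · convert hP _ h.last_mem using 1
      ext v
      have : v ∈ P → v ∉ _ := fun hv => Set.disjoint_left.1 hd hv
      simp only [Set.mem_sdiff, Set.mem_union, Set.mem_singleton_iff]
      tauto
  · obtain ⟨k, u, hk, hu0, huS, hun, huinj, huadj, hrest⟩ :=
      exists_alternating_path (r := w (2 * t + 1)) (y := w 0)
        (Set.singleton_subset_iff.2 h.last_mem) (Set.mem_singleton _)
        (factorCritical_singleton _ _ (Set.mem_singleton _)) (hP _ h.last_mem) h.first_mem
        hab (hP _ h.first_mem)
    set c : ℕ → V := fun j => if j ≤ 2 * t then w (2 * t + 1 - j) else u (j - (2 * t + 1)) with hc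
    have hc₁ : ∀ j ≤ 2 * t, c j = w (2 * t + 1 - j) := fun j hj => by simp only [hc, if_pos hj]
    have hc₂ : ∀ j, 2 * t < j → c j = u (j - (2 * t + 1)) := fun j hj => by
      simp only [hc, if_neg (not_le.2 hj)]
    have hwu : ∀ i ∈ Set.Icc 1 (2 * t), ∀ j < 2 * k, w i ≠ u j := fun i hi j hj he =>
      h.notMem i hi (he ▸ (hun j hj).1)
    have himg : c '' Set.Icc 1 (2 * (t + k)) = w '' Set.Icc 1 (2 * t) ∪ u '' Set.Iio (2 * k) := by
      ext v
      constructor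
      · rintro ⟨j, hj, rfl⟩
        simp only [Set.mem_Icc] at hj
        rcases Nat.lt_or_ge (2 * t) j with hj' | hj'
        · rw [hc₂ j hj']
          exact Or.inr ⟨_, by simp only [Set.mem_Iio]; lia, rfl⟩
        · rw [hc₁ j hj']
          exact Or.inl ⟨_, by simp only [Set.mem_Icc]; lia, rfl⟩
      · rintro (⟨j, hj, rfl⟩ | ⟨j, hj, rfl⟩)
        · simp only [Set.mem_Icc] at hj
          refine ⟨2 * t + 1 - j, by simp only [Set.mem_Icc]; lia, ?_⟩
          rw [hc₁ _ (by lia)]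
          congr 1
          lia
        · simp only [Set.mem_Iio] at hj
          refine ⟨2 * t + 1 + j, by simp only [Set.mem_Icc]; lia, ?_⟩
          rw [hc₂ _ (by lia)]
          congr 1
          lia
    refine ⟨w (2 * t + 1), t + k, c, by lia, ⟨?_, ?_, ?_, ?_, ?_⟩, ?_, ?_⟩
    · rw [hc₁ 0 (by lia)]
      rfl
    · rwa [hc₂ _ (by lia), show 2 * (t + k) + 1 - (2 * t + 1) = 2 * k by lia]
    · intro j hj
      rcases lt_trichotomy j (2 * t) with hj' | hj' | hj'
      · rw [hc₁ j (by lia), hc₁ (j + 1) (by lia)]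
        exact h.reverse.adj j (by lia)
      · rw [hc₁ j (by lia), hc₂ (j + 1) (by lia), hj']
        have := (h.adj 0 (by lia)).symm
        rw [← hu0] at this
        simpa using this
      · rw [hc₂ j (by lia), hc₂ (j + 1) (by lia),
          show j + 1 - (2 * t + 1) = j - (2 * t + 1) + 1 by lia]
        exact huadj _ (by lia)
    · intro i hi j hj hij
      simp only [Set.mem_Icc] at hi hj
      rcases Nat.lt_or_ge (2 * t) i with hi' | hi' <;> rcases Nat.lt_or_ge (2 * t) j with hj' | hj'
      · rw [hc₂ i hi', hc₂ j hj'] at hij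
        have := huinj (by simp only [Set.mem_Iio]; lia) (by simp only [Set.mem_Iio]; lia) hij
        lia
      · rw [hc₂ i hi', hc₁ j hj'] at hij
        exact (hwu _ ⟨by lia, by lia⟩ _ (by lia) hij.symm).elim
      · rw [hc₁ i hi', hc₂ j hj'] at hij
        exact (hwu _ ⟨by lia, by lia⟩ _ (by lia) hij).elim
      · rw [hc₁ i hi', hc₁ j hj'] at hij
        have := h.injOn ⟨by lia, by lia⟩ ⟨by lia, by lia⟩ hij
        lia
    · intro j hj
      simp only [Set.mem_Icc] at hj
      rcases Nat.lt_or_ge (2 * t) j with hj' | hj'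
      · rw [hc₂ j hj']
        exact (hun _ (by lia)).2
      · rw [hc₁ j hj']
        intro he
        exact h.notMem _ ⟨by lia, by lia⟩ (Set.mem_of_eq_of_mem he h.last_mem)
    · rw [himg]
      rintro v (rfl | hv | ⟨j, hj, rfl⟩)
      · exact Or.inl h.last_mem
      · exact Or.inr hv
      · exact Or.inl (hun j hj).1
    · convert hrest using 1
      rw [himg]
      ext v
      have : v ∈ P → v ∉ _ := fun hv => Set.disjoint_left.1 hd hv
      simp only [Set.mem_sdiff, Set.mem_union, Set.mem_singleton_iff]
      tauto

end PerfectlyMatchable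

section EarSubgraphs

variable {V : Type*} {G : SimpleGraph V}

lemma natCard_edgeSet_pathGraph (n : ℕ) : Nat.card (pathGraph (n + 1)).edgeSet = n := by
  let φ : Fin n → (pathGraph (n + 1)).edgeSet := fun i =>
    ⟨s(i.castSucc, i.succ), by simp [pathGraph_adj]⟩
  have hφ : Function.Bijective φ := by
    constructor
    · intro i j hij
      simp only [φ, Subtype.mk.injEq, Sym2.eq_iff, Fin.ext_iff, Fin.val_castSucc,
        Fin.val_succ] at hij
      ext
      lia
    · rintro ⟨e, he⟩
      induction e using Sym2.ind with
      | _ u v =>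
        have := u.isLt
        have := v.isLt
        rcases pathGraph_adj.1 he with h | h
        · refine ⟨⟨u, by lia⟩, ?_⟩
          simp only [φ, Subtype.mk.injEq, Sym2.eq_iff, Fin.ext_iff, Fin.val_castSucc,
            Fin.val_succ]
          lia
        · refine ⟨⟨v, by lia⟩, ?_⟩
          simp only [φ, Subtype.mk.injEq, Sym2.eq_iff, Fin.ext_iff, Fin.val_castSucc,
            Fin.val_succ]
          lia
  rw [← Nat.card_eq_of_bijective φ hφ, Nat.card_eq_fintype_card, Fintype.card_fin]

lemma natCard_edgeSet_cycleGraph (n : ℕ) : Nat.card (cycleGraph (n + 3)).edgeSet = n + 3 := by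
  have h := (cycleGraph (n + 3)).sum_degrees_eq_twice_card_edges
  simp only [cycleGraph_degree_three_le, Finset.sum_const, Finset.card_univ, Fintype.card_fin,
    smul_eq_mul] at h
  rw [Nat.card_eq_fintype_card, card_edgeSet]
  lia

lemma natCard_edgeSet_le_one_of_cycleGraph {n : ℕ} (hn : n < 3) :
    Nat.card (cycleGraph n).edgeSet ≤ 1 := by
  rw [Nat.card_eq_fintype_card, card_edgeSet]
  refine card_edgeFinset_le_card_choose_two.trans ?_
  rw [Fintype.card_fin]
  interval_cases n <;> decide

lemma SimpleGraph.Subgraph.natCard_edgeSet_of_iso (K : G.Subgraph) {W : Type*} {A : SimpleGraph W}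
    (e : K.coe ≃g A) : Nat.card K.edgeSet = Nat.card A.edgeSet := by
  rw [← Nat.card_congr e.mapEdgeSet, ← K.image_coe_edgeSet_coe,
    Nat.card_image_of_injective (Sym2.map.injective Subtype.val_injective)]

lemma natCard_neighborSet_pathGraph_eq_one_iff {n : ℕ} (v : Fin (n + 2)) :
    Nat.card ((pathGraph (n + 2)).neighborSet v) = 1 ↔ v.val = 0 ∨ v.val = n + 1 := by
  rw [Nat.card_coe_set_eq, Set.ncard_eq_one]
  have hv := v.isLt
  constructor
  · rintro ⟨a, ha⟩
    by_contra hne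
    have h₁ : (⟨v - 1, by lia⟩ : Fin (n + 2)) ∈ (pathGraph (n + 2)).neighborSet v := by
      simp only [mem_neighborSet, pathGraph_adj]
      lia
    have h₂ : (⟨v + 1, by lia⟩ : Fin (n + 2)) ∈ (pathGraph (n + 2)).neighborSet v := by
      simp [pathGraph_adj]
    rw [ha, Set.mem_singleton_iff] at h₁ h₂
    have := congrArg Fin.val (h₁.trans h₂.symm)
    simp only at this
    lia
  · rintro (h | h)
    · refine ⟨⟨1, by lia⟩, ?_⟩
      ext u
      simp only [mem_neighborSet, pathGraph_adj, Set.mem_singleton_iff, Fin.ext_iff]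
      lia
    · refine ⟨⟨n, by lia⟩, ?_⟩
      ext u
      have := u.isLt
      simp only [mem_neighborSet, pathGraph_adj, Set.mem_singleton_iff, Fin.ext_iff]
      lia

lemma isEndvertex_iff_of_iso {K : G.Subgraph} {n : ℕ} (e : K.coe ≃g pathGraph (n + 2))
    (x : K.verts) : IsEndvertex K x ↔ (e x).val = 0 ∨ (e x).val = n + 1 := by
  rw [← natCard_neighborSet_pathGraph_eq_one_iff, ← Nat.card_congr (e.mapNeighborSet x),
    Nat.card_congr (Subgraph.coeNeighborSetEquiv x)]
  exact and_iff_right x.2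

open Fin.NatCast in
lemma exists_isOddEar_of_iso_pathGraph {K : G.Subgraph} {P : Set V} {n : ℕ}
    (e : K.coe ≃g pathGraph n) (hodd : Odd (Nat.card K.edgeSet))
    (hend : ∀ x ∈ K.verts, (x ∈ P ↔ IsEndvertex K x)) :
    ∃ (t : ℕ) (w : ℕ → V), IsOddEar G P t w ∧ K.verts \ P = w '' Set.Icc 1 (2 * t) := by
  have hn : ∃ t, n = 2 * t + 2 := by
    rw [K.natCard_edgeSet_of_iso e] at hodd
    rcases n with _ | n
    · simp at hodd
    · rw [natCard_edgeSet_pathGraph] at hodd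
      obtain ⟨t, ht⟩ := hodd
      exact ⟨t, by lia⟩
  obtain ⟨t, rfl⟩ := hn
  have hval : ∀ k, k ≤ 2 * t + 1 → ((k : Fin (2 * t + 2)) : ℕ) = k := fun k hk => by
    rw [Fin.val_natCast, Nat.mod_eq_of_lt (by lia)]
  set w : ℕ → V := fun k => (e.symm (k : Fin (2 * t + 2)) : V) with hw
  have hmem : ∀ k ≤ 2 * t + 1, (w k ∈ P ↔ k = 0 ∨ k = 2 * t + 1) := fun k hk => by
    rw [hend _ (e.symm _).2, isEndvertex_iff_of_iso e, RelIso.apply_symm_apply, hval k hk]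
  refine ⟨t, w, ⟨?_, ?_, ?_, ?_, ?_⟩, ?_⟩
  · rw [hmem 0 (by lia)]
    exact Or.inl rfl
  · rw [hmem _ le_rfl]
    exact Or.inr rfl
  · intro k hk
    refine K.coe_adj_sub _ _ (e.symm.map_adj_iff.2 ?_)
    rw [pathGraph_adj, hval k (by lia), hval (k + 1) (by lia)]
    exact Or.inl rfl
  · intro i hi j hj hij
    simp only [Set.mem_Icc] at hi hj
    have := congrArg Fin.val (e.symm.injective (Subtype.val_injective hij))
    rwa [hval i (by lia), hval j (by lia)] at this
  · intro k hk
    simp only [Set.mem_Icc] at hk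
    rw [hmem k (by lia)]
    lia
  · ext x
    constructor
    · rintro ⟨hx, hxP⟩
      rw [hend x hx, isEndvertex_iff_of_iso e ⟨x, hx⟩] at hxP
      have := (e ⟨x, hx⟩).isLt
      exact ⟨e ⟨x, hx⟩, by simp only [Set.mem_Icc]; lia, by simp [hw]⟩
    · rintro ⟨k, hk, rfl⟩
      simp only [Set.mem_Icc] at hk
      refine ⟨(e.symm _).2, ?_⟩
      rw [hmem k (by lia)]
      lia

open Fin.CommRing in
lemma exists_isOddEar_of_iso_cycleGraph {K : G.Subgraph} {n : ℕ} (e : K.coe ≃g cycleGraph n)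
    (hodd : Odd (Nat.card K.edgeSet)) (hcard : 3 ≤ Nat.card K.edgeSet) {v : V}
    (hv : v ∈ K.verts) :
    ∃ (t : ℕ) (w : ℕ → V), IsOddEar G {v} t w ∧ K.verts = {v} ∪ w '' Set.Icc 1 (2 * t) := by
  have hn : ∃ t, n = 2 * t + 1 + 2 := by
    rw [K.natCard_edgeSet_of_iso e] at hodd hcard
    rcases Nat.lt_or_ge n 3 with hn | hn
    · have := natCard_edgeSet_le_one_of_cycleGraph hn
      lia
    · obtain ⟨q, rfl⟩ := Nat.exists_eq_add_of_le' hn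
      rw [natCard_edgeSet_cycleGraph] at hodd
      obtain ⟨t, ht⟩ := hodd
      exact ⟨t - 1, by lia⟩
  obtain ⟨t, rfl⟩ := hn
  set w : ℕ → V := fun k => (e.symm (e ⟨v, hv⟩ + (k : Fin (2 * t + 1 + 2))) : V) with hw
  have hw0 : w 0 = v := by simp [hw]
  have hinj : ∀ i j, i < 2 * t + 1 + 2 → j < 2 * t + 1 + 2 → w i = w j → i = j := by
    intro i j hi hj hij
    have := congrArg Fin.val (add_left_cancel (e.symm.injective (Subtype.val_injective hij)))
    rwa [Fin.val_natCast, Fin.val_natCast, Nat.mod_eq_of_lt hi, Nat.mod_eq_of_lt hj] at this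
  refine ⟨t + 1, w, ⟨hw0, ?_, ?_, ?_, ?_⟩, ?_⟩
  · have : ((2 * (t + 1) + 1 : ℕ) : Fin (2 * t + 1 + 2)) = 0 := by
      rw [Fin.ext_iff, Fin.val_natCast, show 2 * (t + 1) + 1 = 2 * t + 1 + 2 by lia, Nat.mod_self]
      rfl
    simp only [hw, this, Set.mem_singleton_iff]
    simp
  · intro k hk
    refine K.coe_adj_sub _ _ (e.symm.map_adj_iff.2 ?_)
    rw [cycleGraph_adj]
    right
    push_cast
    ring
  · intro i hi j hj hij
    simp only [Set.mem_Icc] at hi hj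
    exact hinj i j (by lia) (by lia) hij
  · intro k hk he
    simp only [Set.mem_Icc] at hk
    have := hinj k 0 (by lia) (by lia) (he.trans hw0.symm)
    lia
  · ext x
    constructor
    · intro hx
      have hxw : w (e ⟨x, hx⟩ - e ⟨v, hv⟩).val = x := by simp [hw]
      rcases Nat.eq_zero_or_pos (e ⟨x, hx⟩ - e ⟨v, hv⟩).val with h0 | h0
      · left
        rw [← hxw, h0, hw0]
        rfl
      · have := (e ⟨x, hx⟩ - e ⟨v, hv⟩).isLt
        exact Or.inr ⟨_, by simp only [Set.mem_Icc]; lia, hxw⟩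
    · rintro (rfl | ⟨k, -, rfl⟩)
      · exact hv
      · exact (e.symm _).2

lemma SimpleGraph.Copy.mem_toSubgraph_verts {W : Type*} {A : SimpleGraph W} (f : Copy A G) {x : V} :
    x ∈ f.toSubgraph.verts ↔ ∃ a, f a = x := by
  simp [Copy.toSubgraph]

lemma SimpleGraph.Copy.toSubgraph_adj_iff {W : Type*} {A : SimpleGraph W} (f : Copy A G) {x y : V} :
    f.toSubgraph.Adj x y ↔ ∃ a b, A.Adj a b ∧ f a = x ∧ f b = y := by
  simp [Copy.toSubgraph, Relation.Map]

/-- The closed ear `c` as a cycle subgraph. -/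
lemma IsOddEar.exists_cycle {S : Set V} {t : ℕ} {w : ℕ → V} (h : IsOddEar G S t w) (ht : 1 ≤ t)
    (hw : w 0 = w (2 * t + 1)) :
    ∃ K : G.Subgraph, K.verts = {w 0} ∪ w '' Set.Icc 1 (2 * t) ∧
      (∀ x y, K.Adj x y → x ∉ S ∨ y ∉ S) ∧ Nat.card K.edgeSet = 2 * t + 1 ∧
      Nonempty (K.coe ≃g cycleGraph (2 * t + 1)) := by
  have hinj : ∀ i j, i ≤ 2 * t → j ≤ 2 * t → w i = w j → i = j := by
    intro i j hi hj hij
    rcases Nat.eq_zero_or_pos i with rfl | hi' <;> rcases Nat.eq_zero_or_pos j with rfl | hj'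
    · rfl
    · exact (h.notMem j ⟨hj', hj⟩ (hij ▸ h.first_mem)).elim
    · exact (h.notMem i ⟨hi', hi⟩ (hij ▸ h.first_mem)).elim
    · exact h.injOn ⟨hi', hi⟩ ⟨hj', hj⟩ hij
  have hsub : ∀ a b : Fin (2 * t + 1), (a - b).val = 1 →
      a.val = b.val + 1 ∨ (a.val = 0 ∧ b.val = 2 * t) := by
    intro a b hab
    have := a.isLt
    have := b.isLt
    rcases le_or_gt b a with hle | hlt
    · rw [Fin.sub_val_of_le hle] at hab
      lia
    · rw [Fin.coe_sub_iff_lt.2 hlt] at hab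
      have : a.val < b.val := hlt
      lia
  have hadj : ∀ a b : Fin (2 * t + 1), (a - b).val = 1 → G.Adj (w a) (w b) := by
    intro a b hab
    rcases hsub a b hab with hab' | ⟨ha, hb⟩
    · rw [hab']
      exact (h.adj b (by have := b.isLt; lia)).symm
    · rw [ha, hb, hw]
      exact (h.adj (2 * t) le_rfl).symm
  let f : Copy (cycleGraph (2 * t + 1)) G :=
    ⟨⟨fun a => w a, fun {a b} hab => (cycleGraph_adj'.1 hab).elim (hadj a b)
      fun h' => (hadj b a h').symm⟩, fun a b hab => Fin.ext (hinj a b (by have := a.isLt; lia)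
        (by have := b.isLt; lia) hab)⟩
  have hf : ∀ a, f a = w a.val := fun a => rfl
  refine ⟨f.toSubgraph, ?_, ?_, ?_, ⟨f.isoToSubgraph.symm⟩⟩
  · ext x
    rw [f.mem_toSubgraph_verts]
    constructor
    · rintro ⟨a, rfl⟩
      rw [hf]
      rcases Nat.eq_zero_or_pos a.val with ha | ha
      · rw [ha]
        exact Or.inl rfl
      · exact Or.inr ⟨a, ⟨ha, by have := a.isLt; lia⟩, rfl⟩
    · rintro (rfl | ⟨k, hk, rfl⟩)
      · exact ⟨⟨0, by lia⟩, rfl⟩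
      · exact ⟨⟨k, by simp only [Set.mem_Icc] at hk; lia⟩, rfl⟩
  · intro x y hxy
    obtain ⟨a, b, hab, rfl, rfl⟩ := f.toSubgraph_adj_iff.1 hxy
    have ha := a.isLt
    have hb := b.isLt
    rw [hf, hf]
    rcases Nat.eq_zero_or_pos a.val with ha' | ha'
    · refine Or.inr (h.notMem _ ⟨?_, by lia⟩)
      have := Fin.val_ne_of_ne hab.ne
      lia
    · exact Or.inl (h.notMem _ ⟨ha', by lia⟩)
  · rw [Subgraph.natCard_edgeSet_of_iso _ f.isoToSubgraph.symm]
    obtain ⟨s, rfl⟩ := Nat.exists_eq_add_of_le' ht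
    exact natCard_edgeSet_cycleGraph (2 * s)

lemma IsOddEar.exists_path {S : Set V} {t : ℕ} {w : ℕ → V} (h : IsOddEar G S t w) (ht : 1 ≤ t)
    (hw : w 0 ≠ w (2 * t + 1)) :
    ∃ K : G.Subgraph, K.verts = w '' Set.Iio (2 * t + 2) ∧
      (∀ x y, K.Adj x y → x ∉ S ∨ y ∉ S) ∧ Nat.card K.edgeSet = 2 * t + 1 ∧
      Nonempty (K.coe ≃g pathGraph (2 * t + 2)) ∧
      ∀ x ∈ K.verts, (x ∈ S ↔ IsEndvertex K x) := by
  have hS : ∀ k, k ≤ 2 * t + 1 → (w k ∈ S ↔ k = 0 ∨ k = 2 * t + 1) := by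
    refine fun k hk => ⟨fun hkS => ?_, ?_⟩
    · by_contra hne
      exact h.notMem k ⟨by lia, by lia⟩ hkS
    · rintro (rfl | rfl)
      exacts [h.first_mem, h.last_mem]
  have hinj : ∀ i j, i ≤ 2 * t + 1 → j ≤ 2 * t + 1 → w i = w j → i = j := by
    intro i j hi hj hij
    by_cases hiS : w i ∈ S
    · have hjS := hij ▸ hiS
      rw [hS _ hi] at hiS
      rw [hS _ hj] at hjS
      rcases hiS with rfl | rfl <;> rcases hjS with rfl | rfl
      exacts [rfl, (hw hij).elim, (hw hij.symm).elim, rfl]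
    · have hjS := hij ▸ hiS
      rw [hS _ hi] at hiS
      rw [hS _ hj] at hjS
      exact h.injOn ⟨by lia, by lia⟩ ⟨by lia, by lia⟩ hij
  have hadj : ∀ a b : Fin (2 * t + 2), a.val + 1 = b.val → G.Adj (w a) (w b) := by
    intro a b hab
    rw [← hab]
    exact h.adj a (by have := b.isLt; lia)
  let f : Copy (pathGraph (2 * t + 2)) G :=
    ⟨⟨fun a => w a, fun {a b} hab => (pathGraph_adj.1 hab).elim (hadj a b)
      fun h' => (hadj b a h').symm⟩, fun a b hab => Fin.ext (hinj a b (by have := a.isLt; lia)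
        (by have := b.isLt; lia) hab)⟩
  have hf : ∀ a, f a = w a.val := fun a => rfl
  refine ⟨f.toSubgraph, ?_, ?_, ?_, ⟨f.isoToSubgraph.symm⟩, ?_⟩
  · ext x
    rw [f.mem_toSubgraph_verts]
    constructor
    · rintro ⟨a, rfl⟩
      exact ⟨a, a.isLt, rfl⟩
    · rintro ⟨k, hk, rfl⟩
      exact ⟨⟨k, hk⟩, rfl⟩
  · intro x y hxy
    obtain ⟨a, b, hab, rfl, rfl⟩ := f.toSubgraph_adj_iff.1 hxy
    have ha := a.isLt
    have hb := b.isLt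
    rw [pathGraph_adj] at hab
    rw [hf, hf, hS _ (by lia), hS _ (by lia)]
    lia
  · rw [Subgraph.natCard_edgeSet_of_iso _ f.isoToSubgraph.symm, natCard_edgeSet_pathGraph]
  · intro x hx
    have := isEndvertex_iff_of_iso f.isoToSubgraph.symm ⟨x, hx⟩
    obtain ⟨a, ha⟩ : ∃ a, f.isoToSubgraph a = ⟨x, hx⟩ := f.isoToSubgraph.surjective _
    rw [← ha] at this
    rw [RelIso.symm_apply_apply] at this
    have hax : x = w a := by
      have := congrArg Subtype.val ha
      exact this.symm
    rw [ha] at this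
    rw [this, hax, hS _ (by have := a.isLt; lia)]

end EarSubgraphs

section OddEarDecomposition

variable {V : Type*} {G : SimpleGraph V}

lemma IsOddEar.exists_subgraph {S : Set V} {t : ℕ} {w : ℕ → V} (h : IsOddEar G S t w)
    (ht : 1 ≤ t) :
    ∃ K : G.Subgraph, S ∪ K.verts = S ∪ w '' Set.Icc 1 (2 * t) ∧
      (∀ x y, K.Adj x y → x ∉ S ∨ y ∉ S) ∧ Nat.card K.edgeSet = 2 * t + 1 ∧
      (((∃ n, Nonempty (K.coe ≃g pathGraph n)) ∧ ∀ x ∈ K.verts, (x ∈ S ↔ IsEndvertex K x)) ∨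
        ((∃ n, Nonempty (K.coe ≃g cycleGraph n)) ∧ Nat.card (K.verts ∩ S : Set V) = 1)) := by
  by_cases hw : w 0 = w (2 * t + 1)
  · obtain ⟨K, hverts, hadj, hcard, hiso⟩ := h.exists_cycle ht hw
    refine ⟨K, ?_, hadj, hcard, Or.inr ⟨⟨_, hiso⟩, ?_⟩⟩
    · rw [hverts, ← Set.union_assoc,
        Set.union_eq_left.2 (Set.singleton_subset_iff.2 h.first_mem)]
    · rw [Nat.card_coe_set_eq, Set.ncard_eq_one]
      refine ⟨w 0, ?_⟩
      rw [hverts, Set.union_inter_distrib_right, h.disjoint_interior.symm.inter_eq,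
        Set.union_empty, Set.inter_eq_left.2 (Set.singleton_subset_iff.2 h.first_mem)]
  · obtain ⟨K, hverts, hadj, hcard, hiso, hend⟩ := h.exists_path ht hw
    refine ⟨K, ?_, hadj, hcard, Or.inl ⟨⟨_, hiso⟩, hend⟩⟩
    rw [hverts]
    ext x
    constructor
    · rintro (hx | ⟨k, hk, rfl⟩)
      · exact Or.inl hx
      · simp only [Set.mem_Iio] at hk
        by_cases hk' : k ∈ Set.Icc 1 (2 * t)
        · exact Or.inr ⟨k, hk', rfl⟩
        · simp only [Set.mem_Icc] at hk'
          obtain rfl | rfl : k = 0 ∨ k = 2 * t + 1 := by lia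
          exacts [Or.inl h.first_mem, Or.inl h.last_mem]
    · rintro (hx | ⟨k, hk, rfl⟩)
      · exact Or.inl hx
      · simp only [Set.mem_Icc] at hk
        exact Or.inr ⟨k, by simp only [Set.mem_Iio]; lia, rfl⟩

lemma prevVerts_succ (H : ℕ → G.Subgraph) {i : ℕ} (hi : 1 ≤ i) :
    prevVerts H (i + 1) = prevVerts H i ∪ (H i).verts := by
  ext v
  constructor
  · rintro ⟨j, h₁, h₂, hv⟩
    rcases Nat.lt_succ_iff_lt_or_eq.1 h₂ with h | rfl
    · exact Or.inl ⟨j, h₁, h, hv⟩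
    · exact Or.inr hv
  · rintro (⟨j, h₁, h₂, hv⟩ | hv)
    · exact ⟨j, h₁, by lia, hv⟩
    · exact ⟨i, hi, by lia, hv⟩

lemma prevVerts_two (H : ℕ → G.Subgraph) : prevVerts H 2 = (H 1).verts := by
  have h : prevVerts H 1 = ∅ := by
    rw [Set.eq_empty_iff_forall_notMem]
    rintro v ⟨j, h₁, h₂, -⟩
    lia
  rw [prevVerts_succ H le_rfl, h, Set.empty_union]

lemma prevVerts_congr {H H' : ℕ → G.Subgraph} {i : ℕ} (h : ∀ j < i, H j = H' j) :
    prevVerts H i = prevVerts H' i := by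
  ext v
  simp only [prevVerts, Set.mem_ofPred_eq]
  refine exists_congr fun j => and_congr_right fun _ => and_congr_right fun hj => ?_
  rw [h j hj]

/-- `(H 1, …, H m)` is an odd ear decomposition of the subgraph formed by its ears. -/
def IsPartialOddEarDecomp (G : SimpleGraph V) (m : ℕ) (H : ℕ → G.Subgraph) : Prop :=
  1 ≤ m ∧
  (∀ i j, 1 ≤ i → i ≤ m → 1 ≤ j → j ≤ m → i ≠ j →
    Disjoint (H i).edgeSet (H j).edgeSet) ∧
  (∀ i, 1 ≤ i → i ≤ m → Odd (Nat.card (H i).edgeSet) ∧ 3 ≤ Nat.card (H i).edgeSet) ∧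
  (∃ n, Nonempty ((H 1).coe ≃g cycleGraph n)) ∧
  (∀ i, 2 ≤ i → i ≤ m →
    ((∃ n, Nonempty ((H i).coe ≃g pathGraph n)) ∧
      ∀ x ∈ (H i).verts, (x ∈ prevVerts H i ↔ IsEndvertex (H i) x)) ∨
    ((∃ n, Nonempty ((H i).coe ≃g cycleGraph n)) ∧
      Nat.card ((H i).verts ∩ prevVerts H i : Set V) = 1))

lemma IsPartialOddEarDecomp.exists_extend {m : ℕ} {H : ℕ → G.Subgraph}
    (h : IsPartialOddEarDecomp G m H) {t : ℕ} {w : ℕ → V} (ht : 1 ≤ t)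
    (hw : IsOddEar G (prevVerts H (m + 1)) t w) :
    ∃ H' : ℕ → G.Subgraph, IsPartialOddEarDecomp G (m + 1) H' ∧ H' 1 = H 1 ∧
      prevVerts H' (m + 2) = prevVerts H (m + 1) ∪ w '' Set.Icc 1 (2 * t) := by
  obtain ⟨hm, hdisj, hodd, hcyc, hear⟩ := h
  obtain ⟨K, hverts, hadj, hcard, hK⟩ := hw.exists_subgraph ht
  have hold : ∀ j, j ≤ m → Function.update H (m + 1) K j = H j := fun j hj =>
    Function.update_of_ne (by lia) _ _
  have hnew : Function.update H (m + 1) K (m + 1) = K := Function.update_self _ _ _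
  have hprev : ∀ j, j ≤ m + 1 → prevVerts (Function.update H (m + 1) K) j = prevVerts H j :=
    fun j hj => prevVerts_congr fun k hk => hold k (by lia)
  have hdisjK : ∀ j, 1 ≤ j → j ≤ m → Disjoint K.edgeSet (H j).edgeSet := by
    intro j h₁ h₂
    rw [Set.disjoint_left]
    intro e he he'
    induction e using Sym2.ind with
    | _ x y =>
      rw [Subgraph.mem_edgeSet] at he he'
      rcases hadj x y he with hx | hy
      · exact hx ⟨j, h₁, by lia, he'.fst_mem⟩
      · exact hy ⟨j, h₁, by lia, he'.snd_mem⟩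
  refine ⟨Function.update H (m + 1) K, ⟨by lia, ?_, ?_, ?_, ?_⟩, hold 1 hm, ?_⟩
  · intro i j hi hi' hj hj' hij
    rcases Nat.lt_or_ge m i with him | him <;> rcases Nat.lt_or_ge m j with hjm | hjm
    · lia
    · obtain rfl : i = m + 1 := by lia
      rw [hnew, hold j hjm]
      exact hdisjK j hj hjm
    · obtain rfl : j = m + 1 := by lia
      rw [hnew, hold i him]
      exact (hdisjK i hi him).symm
    · rw [hold i him, hold j hjm]
      exact hdisj i j hi him hj hjm hij
  · intro i hi hi'
    rcases Nat.lt_or_ge m i with him | him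
    · obtain rfl : i = m + 1 := by lia
      rw [hnew, hcard]
      exact ⟨odd_two_mul_add_one t, by lia⟩
    · rw [hold i him]
      exact hodd i hi him
  · rwa [hold 1 hm]
  · intro i hi hi'
    rw [hprev i hi']
    rcases Nat.lt_or_ge m i with him | him
    · obtain rfl : i = m + 1 := by lia
      rwa [hnew]
    · rw [hold i him]
      exact hear i hi him
  · rw [prevVerts_succ _ (by lia), hprev _ le_rfl, hnew, hverts]

lemma IsPartialOddEarDecomp.exists_completion [Finite V] (hG : FactorCritical G Set.univ) {m : ℕ}
    {H : ℕ → G.Subgraph} (h : IsPartialOddEarDecomp G m H)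
    (hne : (prevVerts H (m + 1)).Nonempty) (hS : FactorCritical G (prevVerts H (m + 1)))
    (hSc : PerfectlyMatchable G (prevVerts H (m + 1))ᶜ) :
    ∃ (m' : ℕ) (H' : ℕ → G.Subgraph), IsOddEarDecomp G m' H' ∧ H' 1 = H 1 := by
  induction hn : (prevVerts H (m + 1))ᶜ.ncard using Nat.strong_induction_on generalizing m H with
  | _ n ih =>
    by_cases hSu : prevVerts H (m + 1) = Set.univ
    · obtain ⟨hm, hdisj, hodd, hcyc, hear⟩ := h
      refine ⟨m, H, ⟨hm, hdisj, fun v => ?_, hodd, hcyc, hear⟩, rfl⟩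
      obtain ⟨j, h₁, h₂, hv⟩ : v ∈ prevVerts H (m + 1) := hSu ▸ Set.mem_univ v
      exact ⟨j, h₁, by lia, hv⟩
    · obtain ⟨t, w, ht, hw, hrest⟩ := exists_oddEar hG hne hS hSc hSu
      obtain ⟨H', hH', hone, hprev⟩ := h.exists_extend ht hw
      have hFC := hw.factorCritical_union hS
      rw [← hprev] at hrest hFC
      have hlt : (prevVerts H' (m + 1 + 1))ᶜ.ncard < n := by
        rw [← hn]
        have hss : prevVerts H (m + 1) ⊂ prevVerts H' (m + 1 + 1) := by
          rw [hprev]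
          exact Set.ssubset_iff_exists.2 ⟨Set.subset_union_left, w 1,
            Or.inr ⟨1, ⟨le_rfl, by lia⟩, rfl⟩, hw.notMem 1 ⟨le_rfl, by lia⟩⟩
        exact Set.ncard_lt_ncard (compl_lt_compl_iff_lt.2 hss) (Set.toFinite _)
      have hne' : (prevVerts H' (m + 1 + 1)).Nonempty := by
        rw [hprev]
        exact hne.inl
      obtain ⟨m'', H'', h₁, h₂⟩ := ih _ hlt hH' hne' hFC hrest rfl
      exact ⟨m'', H'', h₁, h₂.trans hone⟩

/-- A closed odd ear on its own vertex with perfectly matchable complement is the first cycle of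
some odd ear decomposition. -/
lemma IsOddEar.exists_isOddEarDecomp [Finite V] (hG : FactorCritical G Set.univ) {b : V} {s : ℕ}
    {c : ℕ → V} (h : IsOddEar G {b} s c) (hs : 1 ≤ s)
    (hrest : PerfectlyMatchable G ({b} ∪ c '' Set.Icc 1 (2 * s))ᶜ) :
    ∃ (m : ℕ) (H : ℕ → G.Subgraph), IsOddEarDecomp G m H ∧
      Nat.card (H 1).verts = 2 * s + 1 := by
  have h0 : c 0 = b := h.first_mem
  have hend : c (2 * s + 1) = b := h.last_mem
  obtain ⟨K, hverts, -, hcard, ⟨e⟩⟩ := h.exists_cycle hs (h0.trans hend.symm)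
  rw [h0] at hverts
  have hK : IsPartialOddEarDecomp G 1 (fun _ => K) := by
    refine ⟨le_rfl, fun i j _ _ _ _ _ => by lia, fun i _ _ => ?_, ⟨_, ⟨e⟩⟩,
      fun i _ _ => by lia⟩
    rw [hcard]
    exact ⟨odd_two_mul_add_one s, by lia⟩
  have hprev : prevVerts (fun _ => K) (1 + 1) = {b} ∪ c '' Set.Icc 1 (2 * s) := by
    rw [← hverts]
    exact prevVerts_two _
  have hFC := h.factorCritical_union (factorCritical_singleton b)
  rw [← hprev] at hFC hrest
  obtain ⟨m, H, hH, hone⟩ := hK.exists_completion hG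
    (by rw [hprev]; exact (Set.singleton_nonempty b).inl) hFC hrest
  refine ⟨m, H, hH, ?_⟩
  rw [hone, Nat.card_congr e.toEquiv, Nat.card_eq_fintype_card, Fintype.card_fin]

lemma Hypomatchable.factorCritical (h : Hypomatchable G) : FactorCritical G Set.univ := by
  classical
  intro a _
  obtain ⟨M, hM, hspan⟩ := h a
  choose g hg hguniq using fun v => hM (hspan v)
  refine ⟨fun v => if hv : v ∈ ({a}ᶜ : Set V) then (g ⟨v, hv⟩ : V) else v, ?_⟩
  rintro v ⟨-, hv⟩
  have hv' : v ∈ ({a}ᶜ : Set V) := hv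
  have hgv := (g ⟨v, hv'⟩).2
  simp only [dif_pos hv', dif_pos hgv]
  refine ⟨⟨Set.mem_univ _, hgv⟩, ?_, (hg ⟨v, hv'⟩).adj_sub⟩
  have := hguniq (g ⟨v, hv'⟩) ⟨v, hv'⟩ (hg ⟨v, hv'⟩).symm
  exact congrArg Subtype.val this.symm

namespace IsOddEarDecomp

variable {m : ℕ} {H : ℕ → G.Subgraph}

lemma exists_isOddEar (h : IsOddEarDecomp G m H) {i : ℕ} (hi : 2 ≤ i) (him : i ≤ m) :
    ∃ (t : ℕ) (w : ℕ → V), IsOddEar G (prevVerts H i) t w ∧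
      earQVerts H i = w '' Set.Icc 1 (2 * t) := by
  obtain ⟨hm, -, -, hodd, -, hear⟩ := h
  obtain ⟨ho, hc⟩ := hodd i (by lia) him
  rcases hear i hi him with ⟨⟨n, ⟨e⟩⟩, hend⟩ | ⟨⟨n, ⟨e⟩⟩, hone⟩
  · exact exists_isOddEar_of_iso_pathGraph e ho hend
  · rw [Nat.card_coe_set_eq, Set.ncard_eq_one] at hone
    obtain ⟨v, hv⟩ := hone
    have hvm : v ∈ (H i).verts ∩ prevVerts H i := hv ▸ Set.mem_singleton v
    obtain ⟨t, w, hw, hverts⟩ := exists_isOddEar_of_iso_cycleGraph e ho hc hvm.1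
    have hnot : ∀ k ∈ Set.Icc 1 (2 * t), w k ∉ prevVerts H i := by
      intro k hk hkP
      refine hw.notMem k hk ?_
      rw [← hv]
      refine ⟨?_, hkP⟩
      rw [hverts]
      exact Or.inr ⟨k, hk, rfl⟩
    refine ⟨t, w, ⟨?_, ?_, hw.adj, hw.injOn, hnot⟩, ?_⟩
    · rw [show w 0 = v from hw.first_mem]
      exact hvm.2
    · rw [show w (2 * t + 1) = v from hw.last_mem]
      exact hvm.2
    · rw [earQVerts, hverts]
      ext x
      constructor
      · rintro ⟨rfl | hx, hxP⟩
        · exact (hxP hvm.2).elim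
        · exact hx
      · rintro ⟨k, hk, rfl⟩
        exact ⟨Or.inr ⟨k, hk, rfl⟩, hnot k hk⟩

lemma prevVerts_succ_eq_union_earQVerts (H : ℕ → G.Subgraph) {i : ℕ} (hi : 1 ≤ i) :
    prevVerts H (i + 1) = prevVerts H i ∪ earQVerts H i := by
  rw [prevVerts_succ H hi, earQVerts, Set.union_sdiff_self]

lemma factorCritical_prevVerts (h : IsOddEarDecomp G m H) {i : ℕ} (hi : 2 ≤ i)
    (him : i ≤ m + 1) : FactorCritical G (prevVerts H i) := by
  induction i, hi using Nat.le_induction with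
  | base =>
    obtain ⟨hm, -, -, hodd, ⟨n, ⟨e⟩⟩, -⟩ := h
    obtain ⟨ho, hc⟩ := hodd 1 le_rfl hm
    rw [prevVerts_two]
    intro a ha
    obtain ⟨t, w, hw, hverts⟩ := exists_isOddEar_of_iso_cycleGraph e ho hc ha
    have := hw.factorCritical_union (factorCritical_singleton a)
    rw [← hverts] at this
    exact this a ha
  | succ i hi ih =>
    obtain ⟨t, w, hw, hQ⟩ := h.exists_isOddEar hi (by lia)
    rw [prevVerts_succ_eq_union_earQVerts H (by lia), hQ]
    exact hw.factorCritical_union (ih (by lia))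

lemma prevVerts_mono (H : ℕ → G.Subgraph) : Monotone (prevVerts H) := by
  rintro i k hik v ⟨j, h₁, h₂, hv⟩
  exact ⟨j, h₁, by lia, hv⟩

lemma perfectlyMatchable_prevVerts_diff (h : IsOddEarDecomp G m H) {i k : ℕ} (hi : 2 ≤ i)
    (hik : i ≤ k) (hkm : k ≤ m + 1) : PerfectlyMatchable G (prevVerts H k \ prevVerts H i) := by
  induction k, hik using Nat.le_induction with
  | base => simpa using perfectlyMatchable_empty
  | succ k hik ih =>
    obtain ⟨t, w, hw, hQ⟩ := h.exists_isOddEar (i := k) (by lia) (by lia)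
    have hd := hw.disjoint_interior
    rw [prevVerts_succ_eq_union_earQVerts H (by lia), hQ, Set.union_sdiff_distrib,
      (hd.mono_left (prevVerts_mono H hik)).sdiff_eq_right]
    exact (ih (by lia)).union hw.perfectlyMatchable_interior (hd.mono_left Set.sdiff_subset)

lemma prevVerts_eq_univ (h : IsOddEarDecomp G m H) : prevVerts H (m + 1) = Set.univ := by
  refine Set.eq_univ_of_forall fun v => ?_
  obtain ⟨i, h₁, h₂, hv⟩ := h.2.2.1 v
  exact ⟨i, h₁, by lia, hv⟩

lemma exists_earOrders_eq_cons (h : IsOddEarDecomp G m H) :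
    ∃ L, earOrders m H = Nat.card (H 1).verts :: L := by
  obtain ⟨q, rfl⟩ := Nat.exists_eq_add_of_le' h.1
  rw [earOrders, List.range_succ_eq_map]
  exact ⟨_, rfl⟩

end IsOddEarDecomp

lemma IsMaxOddEarDecomp.natCard_verts_le {m : ℕ} {H : ℕ → G.Subgraph}
    (h : IsMaxOddEarDecomp G m H) {m' : ℕ} {H' : ℕ → G.Subgraph} (h' : IsOddEarDecomp G m' H') :
    Nat.card (H' 1).verts ≤ Nat.card (H 1).verts := by
  by_contra! hlt
  obtain ⟨L, hL⟩ := h.1.exists_earOrders_eq_cons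
  obtain ⟨L', hL'⟩ := h'.exists_earOrders_eq_cons
  refine h.2 m' H' h' ?_
  rw [hL, hL']
  exact List.Lex.rel hlt

end OddEarDecomposition

/-- Let `G` be a hypomatchable graph of order at least three with an odd ear decomposition
`(H 1, …, H m)` satisfying (H1), where `|V(H 1)| = 2l+1`.  Then for each `2 ≤ i ≤ m`,
`|V(Q(i))| ≤ 2l` where `Q(i) = H i - ⋃_{1 ≤ j ≤ i-1} V(H_j)`. -/
theorem stmt5 {V : Type} [Fintype V] (G : SimpleGraph V) (hG : Hypomatchable G)
    (hV : 3 ≤ Nat.card V) (m : ℕ) (H : ℕ → G.Subgraph)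
    (hmax : IsMaxOddEarDecomp G m H)
    (l : ℕ) (hl : Nat.card (H 1).verts = 2 * l + 1)
    (i : ℕ) (hi2 : 2 ≤ i) (him : i ≤ m) :
    Nat.card (earQVerts H i) ≤ 2 * l := by
  have h := hmax.1
  obtain ⟨t, w, hw, hQ⟩ := h.exists_isOddEar hi2 him
  have hcard : Nat.card (earQVerts H i) = 2 * t := by
    rw [hQ, Nat.card_image_of_injOn hw.injOn]
    simp
  rw [hcard]
  by_contra! hlt
  obtain ⟨b, s, c, hts, hc, hsub, hrest⟩ :=
    hw.exists_closed (h.factorCritical_prevVerts hi2 (by lia))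
  have hout := h.perfectlyMatchable_prevVerts_diff (i := i + 1) (by lia) (by lia) le_rfl
  rw [h.prevVerts_eq_univ, ← Set.compl_eq_univ_sdiff,
    IsOddEarDecomp.prevVerts_succ_eq_union_earQVerts H (by lia), hQ] at hout
  have hcompl := hrest.union hout (disjoint_compl_right.mono_left Set.sdiff_subset)
  have hset : ∀ A B : Set V, B ⊆ A → A \ B ∪ Aᶜ = Bᶜ := fun A B hBA => by
    ext v
    have := @hBA v
    simp only [Set.mem_union, Set.mem_sdiff, Set.mem_compl_iff]
    tauto
  rw [hset _ _ hsub] at hcompl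
  obtain ⟨m', H', hH', hcard'⟩ := hc.exists_isOddEarDecomp hG.factorCritical (by lia) hcompl
  have := hmax.natCard_verts_le hH'
  lia
end

section
/- Let k ≥ 2 be an integer, let H be the graph on 8 vertices x₁, …, x₈ consisting of the cycle x₁x₂⋯x₈x₁ together with the chords x₂x₄, x₄x₆, x₆x₈, x₈x₂, with u = x₁ and v = x₅, and let X ⊆ V(H) be a set with {u, v} ⊆ X. Then ∑_{0≤j≤k−1} c_{2j+1}(H−X) ≤ 2. -/
open SimpleGraph

/-- The number of connected components of `G - X` having exactly `j` vertices. -/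
noncomputable def cComp {V : Type*} (G : SimpleGraph V) (X : Set V) (j : ℕ) : ℕ :=
  Nat.card {C : (G.induce Xᶜ).ConnectedComponent // Nat.card C.supp = j}

/-- The graph `H` on 8 vertices `x₁, …, x₈` (represented by `0, …, 7`): the cycle
`x₁x₂⋯x₈x₁` together with the chords `x₂x₄, x₄x₆, x₆x₈, x₈x₂`. -/
def Hgraph : SimpleGraph (Fin 8) :=
  SimpleGraph.fromRel (fun a b =>
    b.val = (a.val + 1) % 8 ∨ (a.val % 2 = 1 ∧ b.val = (a.val + 2) % 8))

/-- Counting components by size along distinct sizes counts each component at most once. -/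
theorem sum_cComp_le_card_connectedComponent {V ι : Type*} [Finite V] (G : SimpleGraph V)
    (X : Set V) (s : Finset ι) {f : ι → ℕ} (hf : f.Injective) :
    ∑ j ∈ s, cComp G X (f j) ≤ Nat.card (G.induce Xᶜ).ConnectedComponent := by
  classical
  have := Fintype.ofFinite (G.induce Xᶜ).ConnectedComponent
  simp only [cComp, Nat.card_eq_fintype_card (α := {C : (G.induce Xᶜ).ConnectedComponent // _}),
    Fintype.card_subtype]
  rw [← Finset.card_biUnion, Nat.card_eq_fintype_card]
  · exact Finset.card_le_univ _
  · intro i _ j _ hij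
    exact Finset.disjoint_filter.2 fun C _ hi hj => hij (hf (hi.symm.trans hj))

/-- A graph whose vertices are partitioned into cliques by `c : V → β` has at most `|β|`
connected components. -/
theorem card_connectedComponent_le_of_adj {V β : Type*} [Finite β] (G : SimpleGraph V)
    (c : V → β) (hc : ∀ a b, c a = c b → a ≠ b → G.Adj a b) :
    Nat.card G.ConnectedComponent ≤ Nat.card β := by
  refine Nat.card_le_card_of_injective (fun C => c C.out) fun C D h => ?_
  rw [← Quot.out_eq C, ← Quot.out_eq D]
  refine ConnectedComponent.sound ?_
  by_cases hCD : C.out = D.out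
  · rw [hCD]
  · exact (hc _ _ h hCD).reachable

/-- The sets `{x₂, x₃, x₄}` and `{x₆, x₇, x₈}` are cliques of `H`. -/
theorem Hgraph_adj_of_same_side {a b : Fin 8} (ha : a ≠ 0 ∧ a ≠ 4) (hb : b ≠ 0 ∧ b ≠ 4)
    (h : decide (a < 4) = decide (b < 4)) (hab : a ≠ b) : Hgraph.Adj a b := by
  rw [Hgraph, fromRel_adj]
  revert a b
  decide

/-- For `k ≥ 2`, `u = x₁`, `v = x₅`, and `X ⊆ V(H)` with `{u, v} ⊆ X`, we have
`∑_{0 ≤ j ≤ k-1} c_{2j+1}(H - X) ≤ 2`. -/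
theorem stmt9 (k : ℕ) (hk : 2 ≤ k) (X : Set (Fin 8)) (hX : (0 : Fin 8) ∈ X ∧ (4 : Fin 8) ∈ X) :
    ∑ j ∈ Finset.range k, cComp Hgraph X (2 * j + 1) ≤ 2 := by
  calc
    _ ≤ Nat.card (Hgraph.induce Xᶜ).ConnectedComponent :=
      sum_cComp_le_card_connectedComponent Hgraph X _ fun i j h => by lia
    _ ≤ Nat.card Bool := by
      have ne_of_notMem (a : ↥Xᶜ) : a.1 ≠ 0 ∧ a.1 ≠ 4 :=
        ⟨fun h => a.2 (h ▸ hX.1), fun h => a.2 (h ▸ hX.2)⟩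
      exact card_connectedComponent_le_of_adj _ (fun a => decide (a.1 < 4)) fun a b h hab =>
        Hgraph_adj_of_same_side (ne_of_notMem a) (ne_of_notMem b) h
          (Subtype.coe_injective.ne hab)
    _ = 2 := by simp
end

section
/- Let k ≥ 2 be an integer, let H be the graph on 8 vertices x₁, …, x₈ consisting of the cycle x₁x₂⋯x₈x₁ together with the chords x₂x₄, x₄x₆, x₆x₈, x₈x₂, with u = x₁ and v = x₅, and let X ⊆ V(H) be a set with {u, v} ⊆ X. If ∑_{0≤j≤k−1} c_{2j+1}(H−X) = 1, then |X| ≥ 3. -/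
open SimpleGraph

theorem cComp_eq_zero_of_connected {V : Type*} {G : SimpleGraph V} {X : Set V} {j : ℕ}
    (hG : (G.induce Xᶜ).Connected) (hj : Nat.card (Xᶜ : Set V) ≠ j) : cComp G X j = 0 := by
  have := hG.preconnected.subsingleton_connectedComponent
  have hempty : IsEmpty
      {C : (G.induce Xᶜ).ConnectedComponent // Nat.card C.supp = j} := by
    refine ⟨fun ⟨C, hC⟩ => hj ?_⟩
    have hsupp : C.supp = Set.univ :=
      Set.eq_univ_of_forall fun v => Subsingleton.elim _ C
    rwa [hsupp, Nat.card_univ] at hC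
  exact Nat.card_of_isEmpty

theorem connected_induce_Hgraph_compl :
    (Hgraph.induce ({0, 4}ᶜ : Set (Fin 8))).Connected := by
  have hadj : ∀ a b : Fin 8, Hgraph.Adj a b ↔ a ≠ b ∧
      ((b.val = (a.val + 1) % 8 ∨ (a.val % 2 = 1 ∧ b.val = (a.val + 2) % 8)) ∨
        (a.val = (b.val + 1) % 8 ∨ (b.val % 2 = 1 ∧ a.val = (b.val + 2) % 8))) :=
    fun _ _ => Iff.rfl
  let G := Hgraph.induce ({0, 4}ᶜ : Set (Fin 8))
  have step : ∀ (a b : Fin 8) (ha : a ∈ ({0, 4}ᶜ : Set (Fin 8)))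
      (hb : b ∈ ({0, 4}ᶜ : Set (Fin 8))), Hgraph.Adj a b → G.Reachable ⟨a, ha⟩ ⟨b, hb⟩ :=
    fun a b ha hb h => SimpleGraph.Adj.reachable (G := G) (u := ⟨a, ha⟩) (v := ⟨b, hb⟩) h
  have h12 := step 1 2 (by simp) (by simp) (by rw [hadj]; decide)
  have h13 := step 1 3 (by simp) (by simp) (by rw [hadj]; decide)
  have h17 := step 1 7 (by simp) (by simp) (by rw [hadj]; decide)
  have h35 := step 3 5 (by simp) (by simp) (by rw [hadj]; decide)
  have h76 := step 7 6 (by simp) (by simp) (by rw [hadj]; decide)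
  rw [SimpleGraph.connected_iff_exists_forall_reachable]
  refine ⟨⟨1, by simp⟩, ?_⟩
  rintro ⟨w, hw⟩
  fin_cases w
  · simp at hw
  · exact .rfl
  · exact h12
  · exact h13
  · simp at hw
  · exact h13.trans h35
  · exact h17.trans h76
  · exact h17

/-- For `k ≥ 2`, `u = x₁`, `v = x₅`, and `X ⊆ V(H)` with `{u, v} ⊆ X`:
if `∑_{0 ≤ j ≤ k-1} c_{2j+1}(H - X) = 1`, then `|X| ≥ 3`. -/
theorem stmt10 (k : ℕ) (hk : 2 ≤ k) (X : Set (Fin 8)) (hX : (0 : Fin 8) ∈ X ∧ (4 : Fin 8) ∈ X)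
    (h1 : ∑ j ∈ Finset.range k, cComp Hgraph X (2 * j + 1) = 1) :
    3 ≤ Nat.card X := by
  by_contra hcard
  rw [Nat.card_coe_set_eq] at hcard
  have hsub : ({0, 4} : Set (Fin 8)) ⊆ X := by
    rintro x (rfl | rfl)
    exacts [hX.1, hX.2]
  have hpair : ({0, 4} : Set (Fin 8)).ncard = 2 := Set.ncard_pair (by decide)
  obtain rfl : ({0, 4} : Set (Fin 8)) = X := Set.eq_of_subset_of_ncard_le hsub (by omega)
  have hcompl : Nat.card (({0, 4} : Set (Fin 8))ᶜ : Set (Fin 8)) = 6 := by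
    rw [Nat.card_coe_set_eq, Set.ncard_compl, hpair, Nat.card_fin]
  rw [Finset.sum_eq_zero fun j _ =>
    cComp_eq_zero_of_connected connected_induce_Hgraph_compl (by omega)] at h1
  omega
end

section
/- The graph Q has no Hamiltonian path. -/
open SimpleGraph

/-- `l = 2⌊(k-12)/17⌋`. -/
def lP (k : ℕ) : ℕ := 2 * ((k - 12) / 17)

/-- `m = ⌊(2k-l+1)/8⌋`. -/
def mP (k : ℕ) : ℕ := (2 * k - lP k + 1) / 8

/-- `r = 2k+1-l-8m`. -/
def rP (k : ℕ) : ℕ := 2 * k + 1 - lP k - 8 * mP k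

/-- The vertex type of the graph `T`: `m` disjoint copies of `H` together with a set `R`
of `r` further vertices. -/
abbrev TV (k : ℕ) : Type := (Fin (mP k) × Fin 8) ⊕ Fin (rP k)

/-- Membership in `U ∪ R`, where `U = {uᵢ, vᵢ : 1 ≤ i ≤ m}` consists of the copies of
`u = x₁ = 0` and `v = x₅ = 4`, and `R` is the set of `r` extra vertices. -/
def inUR (k : ℕ) : TV k → Prop
  | Sum.inl (_, a) => a = 0 ∨ a = 4
  | Sum.inr _ => True

/-- The graph `T`: the disjoint union `H₁ ∪ ⋯ ∪ H_m` together with the vertices of `R`,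
where all pairs of distinct vertices of `U ∪ R` are joined. -/
def Tgraph (k : ℕ) : SimpleGraph (TV k) :=
  SimpleGraph.fromRel (fun s t =>
    (match s, t with
      | Sum.inl (i, a), Sum.inl (j, b) => i = j ∧ Hgraph.Adj a b
      | _, _ => False) ∨ (inUR k s ∧ inUR k t))

/-- The vertex type of `Q = L + T` where `L` is a complete graph of order `l`. -/
abbrev QV (k : ℕ) : Type := Fin (lP k) ⊕ TV k

/-- The graph `Q = L + T`, the join of the complete graph `L` of order `l` with `T`. -/
def Qgraph (k : ℕ) : SimpleGraph (QV k) :=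
  SimpleGraph.fromRel (fun x y =>
    match x, y with
    | Sum.inl _, _ => True
    | Sum.inr s, Sum.inr t => (Tgraph k).Adj s t
    | _, _ => False)


/-- A Hamiltonian path numbers the vertices injectively by `0, …, N` so that consecutive vertices
are adjacent. -/
lemma SimpleGraph.Walk.IsHamiltonian.exists_position {V : Type*} [DecidableEq V]
    {G : SimpleGraph V} {a b : V} {p : G.Walk a b} (hp : p.IsHamiltonian) :
    ∃ (N : ℕ) (pos : V → ℕ), Function.Injective pos ∧ (∀ x, pos x ≤ N) ∧
      (∀ n ≤ N, ∃ x, pos x = n) ∧ ∀ x y, pos y = pos x + 1 → G.Adj x y := by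
  have hex : ∀ x, ∃ n, p.getVert n = x ∧ n ≤ p.length := fun x =>
    SimpleGraph.Walk.mem_support_iff_exists_getVert.mp (hp.mem_support x)
  choose pos hget hle using hex
  refine ⟨p.length, pos, fun x y h => by rw [← hget x, h, hget y], hle,
    fun n hn => ⟨p.getVert n, hp.isPath.getVert_injOn (hle _) hn (hget _)⟩, fun x y h => ?_⟩
  have hadj := p.adj_getVert_succ (i := pos x) (by have := hle y; omega)
  rwa [← h, hget, hget] at hadj

lemma Hgraph_adj_iff (a b : Fin 8) : Hgraph.Adj a b ↔ a ≠ b ∧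
    ((b.val = (a.val + 1) % 8 ∨ (a.val % 2 = 1 ∧ b.val = (a.val + 2) % 8)) ∨
      (a.val = (b.val + 1) % 8 ∨ (b.val % 2 = 1 ∧ a.val = (b.val + 2) % 8))) := by
  simp [Hgraph, SimpleGraph.fromRel_adj]

/-- The vertices of `H` cannot be placed injectively on a line so that every vertex other than
`u` and `v` has a neighbour immediately before it and one immediately after it. -/
lemma Hgraph_no_line_placement (f : Fin 8 → ℕ) (hf : Function.Injective f)
    (hsucc : ∀ a, a ≠ 0 → a ≠ 4 → ∃ b, Hgraph.Adj a b ∧ f b = f a + 1)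
    (hpred : ∀ a, a ≠ 0 → a ≠ 4 → ∃ b, Hgraph.Adj a b ∧ f a = f b + 1) : False := by
  have hne : ∀ a b, a ≠ b → f a ≠ f b := fun a b h h' => h (hf h')
  have n25 := hne 2 5 (by decide)
  have n35 := hne 3 5 (by decide)
  have n36 := hne 3 6 (by decide)
  simp only [Hgraph_adj_iff] at hsucc hpred
  have arc2 : (f 2 = f 1 + 1 ∧ f 3 = f 2 + 1 ∧ (f 1 = f 0 + 1 ∨ f 1 = f 7 + 1) ∧
        (f 4 = f 3 + 1 ∨ f 5 = f 3 + 1)) ∨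
      (f 1 = f 2 + 1 ∧ f 2 = f 3 + 1 ∧ (f 0 = f 1 + 1 ∨ f 7 = f 1 + 1) ∧
        (f 3 = f 4 + 1 ∨ f 3 = f 5 + 1)) := by
    have s1 := hsucc 1 (by decide) (by decide)
    have s2 := hsucc 2 (by decide) (by decide)
    have s3 := hsucc 3 (by decide) (by decide)
    have p1 := hpred 1 (by decide) (by decide)
    have p2 := hpred 2 (by decide) (by decide)
    have p3 := hpred 3 (by decide) (by decide)
    simp [Fin.exists_fin_succ] at s1 s2 s3 p1 p2 p3
    clear hsucc hpred hne
    rcases s2 with s2 | s2 <;> rcases p2 with p2 | p2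
    · omega
    · right; clear s3 p1; omega
    · left; clear s1 p3; omega
    · omega
  have arc6 : (f 6 = f 5 + 1 ∧ f 7 = f 6 + 1 ∧ (f 5 = f 4 + 1 ∨ f 5 = f 3 + 1) ∧
        (f 0 = f 7 + 1 ∨ f 1 = f 7 + 1)) ∨
      (f 5 = f 6 + 1 ∧ f 6 = f 7 + 1 ∧ (f 4 = f 5 + 1 ∨ f 3 = f 5 + 1) ∧
        (f 7 = f 0 + 1 ∨ f 7 = f 1 + 1)) := by
    have s5 := hsucc 5 (by decide) (by decide)
    have s6 := hsucc 6 (by decide) (by decide)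
    have s7 := hsucc 7 (by decide) (by decide)
    have p5 := hpred 5 (by decide) (by decide)
    have p6 := hpred 6 (by decide) (by decide)
    have p7 := hpred 7 (by decide) (by decide)
    simp [Fin.exists_fin_succ] at s5 s6 s7 p5 p6 p7
    clear hsucc hpred hne
    rcases s6 with s6 | s6 <;> rcases p6 with p6 | p6
    · omega
    · right; clear s7 p5; omega
    · left; clear s5 p7; omega
    · omega
  clear hsucc hpred hne
  rcases arc2 with ⟨_, _, _ | _, _ | _⟩ | ⟨_, _, _ | _, _ | _⟩ <;>
    rcases arc6 with ⟨_, _, _ | _, _ | _⟩ | ⟨_, _, _ | _, _ | _⟩ <;> omega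

lemma Qgraph_adj_interior {k : ℕ} {i : Fin (mP k)} {a : Fin 8} {y : QV k} (h0 : a ≠ 0)
    (h4 : a ≠ 4) (h : (Qgraph k).Adj (Sum.inr (Sum.inl (i, a))) y) :
    (∃ c, y = Sum.inl c) ∨ ∃ b, y = Sum.inr (Sum.inl (i, b)) ∧ Hgraph.Adj a b := by
  rcases y with c | ⟨j, b⟩ | c
  · exact Or.inl ⟨c, rfl⟩
  · simp [Qgraph, Tgraph, SimpleGraph.fromRel_adj, inUR, h0, h4] at h
    right
    grind [SimpleGraph.Adj.symm]
  · simp [Qgraph, Tgraph, SimpleGraph.fromRel_adj, inUR, h0, h4] at h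

lemma two_mul_lP_add_three_le_mP {k : ℕ} (hk : 29 ≤ k) : 2 * lP k + 3 ≤ mP k := by
  unfold mP lP
  omega

/-- For `k ≥ 29`, the graph `Q` has no Hamiltonian path. -/
theorem stmt12 (k : ℕ) (hk : 29 ≤ k) :
    ¬ ∃ (a b : QV k) (p : (Qgraph k).Walk a b), p.IsHamiltonian := by
  rintro ⟨a, b, p, hp⟩
  obtain ⟨N, pos, hinj, hle, hsurj, hadj⟩ := hp.exists_position
  let tagged : Bool × Option (Fin (lP k)) → ℕ → Prop
    | (false, none), n => n = 0
    | (true, none), n => n = N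
    | (false, some c), n => n + 1 = pos (Sum.inl c)
    | (true, some c), n => n = pos (Sum.inl c) + 1
  have htagged : ∀ t n n', tagged t n → tagged t n' → n = n' := by
    rintro ⟨_ | _, _ | c⟩ n n' <;> simp only [tagged] <;> omega
  have hcopy : ∀ i : Fin (mP k), ∃ t a, tagged t (pos (Sum.inr (Sum.inl (i, a)))) := by
    intro i
    by_contra! hno
    refine Hgraph_no_line_placement (fun a => pos (Sum.inr (Sum.inl (i, a))))
      (fun a b h => by simpa using hinj h) (fun a h0 h4 => ?_) (fun a h0 h4 => ?_)
    · have hlast : pos (Sum.inr (Sum.inl (i, a))) ≠ N := hno (true, none) a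
      have hlt := lt_of_le_of_ne (hle _) hlast
      obtain ⟨y, hy⟩ := hsurj _ hlt
      rcases Qgraph_adj_interior h0 h4 (hadj _ _ hy) with ⟨c, rfl⟩ | ⟨b, rfl, hb⟩
      · exact absurd hy.symm (hno (false, some c) a)
      · exact ⟨b, hb, hy⟩
    · have hfirst : pos (Sum.inr (Sum.inl (i, a))) ≠ 0 := hno (false, none) a
      obtain ⟨y, hy⟩ := hsurj (pos (Sum.inr (Sum.inl (i, a))) - 1) ((Nat.sub_le _ _).trans (hle _))
      have hy' : pos (Sum.inr (Sum.inl (i, a))) = pos y + 1 := by omega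
      rcases Qgraph_adj_interior h0 h4 (hadj _ _ hy').symm with ⟨c, rfl⟩ | ⟨b, rfl, hb⟩
      · exact absurd hy' (hno (true, some c) a)
      · exact ⟨b, hb, hy'⟩
  choose t x ht using hcopy
  have ht_inj : Function.Injective t := fun i j hij => by
    have h := hinj (htagged _ _ _ (ht i) (hij ▸ ht j))
    simp only [Sum.inr.injEq, Sum.inl.injEq, Prod.mk.injEq] at h
    exact h.1
  have hcard := Fintype.card_le_of_injective t ht_inj
  simp only [Fintype.card_fin, Fintype.card_prod, Fintype.card_bool, Fintype.card_option] at hcard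
  have := two_mul_lP_add_three_le_mP hk
  omega
end

section
/- For every subset X ⊆ V(Q), ∑_{0≤j≤k−1} c_{2j+1}(Q−X) ≤ ((32k+141)/(72k−78))·|X| + (32k−879)/(288k−312). -/
open SimpleGraph

/-- The sum of the numbers of components of distinct odd orders is at most the number of
all components. -/
theorem sum_cComp_le_card {V : Type*} [Finite V] (G : SimpleGraph V) (X : Set V) (k : ℕ) :
    ∑ j ∈ Finset.range k, cComp G X (2 * j + 1) ≤
      Nat.card (G.induce Xᶜ).ConnectedComponent := by
  classical
  rw [← Fin.sum_univ_eq_sum_range (fun j => cComp G X (2 * j + 1)) k]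
  unfold cComp
  rw [← Nat.card_sigma]
  refine Nat.card_le_card_of_injective (fun p => p.2.1) ?_
  rintro ⟨i, C, hC⟩ ⟨j, D, hD⟩ h
  obtain rfl : C = D := h
  have hij : i = j := Fin.ext (by omega)
  subst hij
  rfl

/-- The side of the cycle `x₁ ⋯ x₈`, cut at `x₁` and `x₅`, on which a vertex lies. -/
def cycleSide (a : Fin 8) : Bool := decide (a.val < 4)

/-- One of the two vertices `x₁`, `x₅`. -/
def hubVertex (e : Bool) : Fin 8 := if e then 4 else 0

/-- The neighbour of `hubVertex e` on side `b`. -/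
def portVertex (b e : Bool) : Fin 8 :=
  if b then (if e then 3 else 1) else (if e then 5 else 7)

instance : DecidableRel Hgraph.Adj := fun a b => by
  unfold Hgraph
  rw [SimpleGraph.fromRel_adj]
  infer_instance

theorem Hgraph_adj_of_cycleSide_eq : ∀ a b : Fin 8, a ≠ 0 → a ≠ 4 → b ≠ 0 → b ≠ 4 →
    cycleSide a = cycleSide b → a ≠ b → Hgraph.Adj a b := by
  decide

theorem Hgraph_adj_port_hub : ∀ b e, Hgraph.Adj (portVertex b e) (hubVertex e) := by
  decide

theorem Hgraph_adj_port_port :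
    ∀ b c e, b ≠ c → Hgraph.Adj (portVertex b e) (portVertex c e) := by
  decide

theorem portVertex_spec : ∀ b e, portVertex b e ≠ 0 ∧ portVertex b e ≠ 4 ∧
    cycleSide (portVertex b e) = b := by
  decide

theorem portVertex_injective : ∀ b e b' e', portVertex b e = portVertex b' e' →
    b = b' ∧ e = e' := by
  decide

theorem hubVertex_injective : ∀ e e', hubVertex e = hubVertex e' → e = e' := by
  decide

theorem portVertex_ne_hubVertex : ∀ b e e', portVertex b e ≠ hubVertex e' := by
  decide

theorem hubVertex_eq : ∀ e, hubVertex e = 0 ∨ hubVertex e = 4 := by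
  decide

theorem Qgraph_adj_left (k : ℕ) (z : Fin (lP k)) (y : QV k) (h : Sum.inl z ≠ y) :
    (Qgraph k).Adj (Sum.inl z) y := by
  rw [Qgraph, SimpleGraph.fromRel_adj]
  exact ⟨h, Or.inl trivial⟩

theorem Qgraph_adj_of_inUR (k : ℕ) {s t : TV k} (hs : inUR k s) (ht : inUR k t) (h : s ≠ t) :
    (Qgraph k).Adj (Sum.inr s) (Sum.inr t) := by
  rw [Qgraph, SimpleGraph.fromRel_adj]
  refine ⟨fun e => h (Sum.inr_injective e), Or.inl ?_⟩
  change (Tgraph k).Adj s t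
  rw [Tgraph, SimpleGraph.fromRel_adj]
  exact ⟨h, Or.inl (Or.inr ⟨hs, ht⟩)⟩

theorem Qgraph_adj_of_Hgraph_adj (k : ℕ) (i : Fin (mP k)) {a b : Fin 8} (h : Hgraph.Adj a b) :
    (Qgraph k).Adj (Sum.inr (Sum.inl (i, a))) (Sum.inr (Sum.inl (i, b))) := by
  have hne := h.ne
  rw [Qgraph, SimpleGraph.fromRel_adj]
  refine ⟨by simpa using hne, Or.inl ?_⟩
  change (Tgraph k).Adj _ _
  rw [Tgraph, SimpleGraph.fromRel_adj]
  exact ⟨by simpa using hne, Or.inl (Or.inl ⟨rfl, h⟩)⟩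

/-- Vertices outside `X` that are equal or adjacent lie in the same component of `G - X`. -/
theorem componentMk_eq_of_adj {V : Type*} {G : SimpleGraph V} {X : Set V} {x y : V}
    (hx : x ∈ Xᶜ) (hy : y ∈ Xᶜ) (h : x ≠ y → G.Adj x y) :
    (G.induce Xᶜ).connectedComponentMk ⟨x, hx⟩ =
      (G.induce Xᶜ).connectedComponentMk ⟨y, hy⟩ := by
  by_cases hxy : x = y
  · subst hxy
    rfl
  · rw [SimpleGraph.ConnectedComponent.eq]
    exact SimpleGraph.Adj.reachable (h hxy)

/-- The components of `Q - X` that avoid `U ∪ R`. -/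
abbrev OuterComponent (k : ℕ) (X : Set (QV k)) : Type :=
  {C : ((Qgraph k).induce Xᶜ).ConnectedComponent //
    ∀ s (hs : Sum.inr s ∈ Xᶜ), inUR k s →
      ((Qgraph k).induce Xᶜ).connectedComponentMk ⟨Sum.inr s, hs⟩ ≠ C}

theorem card_component_le_card_outerComponent (k : ℕ) (X : Set (QV k)) :
    Nat.card ((Qgraph k).induce Xᶜ).ConnectedComponent ≤
      Nat.card (OuterComponent k X) + 1 := by
  classical
  rw [← Finite.card_option]
  refine Nat.card_le_card_of_injective
    (fun C => if h : _ then some (⟨C, h⟩ : OuterComponent k X) else none) ?_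
  intro C D h
  dsimp only at h
  split_ifs at h with h₁ h₂ h₂
  · simpa using h
  · push Not at h₁ h₂
    obtain ⟨s, hs, hsU, rfl⟩ := h₁
    obtain ⟨t, ht, htU, rfl⟩ := h₂
    exact componentMk_eq_of_adj hs ht fun hst =>
      Qgraph_adj_of_inUR k hsU htU fun e => hst (congrArg _ e)

theorem OuterComponent.exists_rep {k : ℕ} {X : Set (QV k)} (hX : ∀ z, Sum.inl z ∈ X)
    (C : OuterComponent k X) : ∃ (q : Fin (mP k) × Fin 8)
      (hq : Sum.inr (Sum.inl q) ∈ Xᶜ), q.2 ≠ 0 ∧ q.2 ≠ 4 ∧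
      ((Qgraph k).induce Xᶜ).connectedComponentMk ⟨Sum.inr (Sum.inl q), hq⟩ = C.1 := by
  obtain ⟨C, hC⟩ := C
  induction C using SimpleGraph.ConnectedComponent.ind with
  | h v =>
    obtain ⟨v, hv⟩ := v
    rcases v with z | ⟨⟨i, a⟩⟩ | j
    · exact absurd (hX z) hv
    · refine ⟨(i, a), hv, ?_, ?_, rfl⟩
      · exact fun h => hC _ hv (Or.inl h) rfl
      · exact fun h => hC _ hv (Or.inr h) rfl
    · exact absurd rfl (hC _ hv trivial)

/-- If `L ⊆ X`, the components of `Q - X` avoiding `U ∪ R` are at most `2m` in number, and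
at most half as many as the vertices of `X` in `T`. -/
theorem card_outerComponent_le {k : ℕ} {X : Set (QV k)} (hX : ∀ z, Sum.inl z ∈ X) :
    Nat.card (OuterComponent k X) ≤ 2 * mP k ∧
      2 * Nat.card (OuterComponent k X) ≤ Nat.card {t : TV k // Sum.inr t ∈ X} := by
  classical
  choose q hq h0 h4 hmk using OuterComponent.exists_rep hX
  have hinj : ∀ C D, (q C).1 = (q D).1 → cycleSide (q C).2 = cycleSide (q D).2 → C = D := by
    intro C D h₁ h₂
    apply Subtype.ext
    rw [← hmk C, ← hmk D]
    refine componentMk_eq_of_adj _ _ fun hne => ?_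
    have hq2 : (q C).2 ≠ (q D).2 := fun h => hne (by rw [Prod.ext h₁ h])
    have := Qgraph_adj_of_Hgraph_adj k (q C).1
      (Hgraph_adj_of_cycleSide_eq _ _ (h0 C) (h4 C) (h0 D) (h4 D) h₂ hq2)
    nth_rewrite 2 [h₁] at this
    exact this
  have hport : ∀ C e (h : Sum.inr (Sum.inl ((q C).1, portVertex (cycleSide (q C).2) e)) ∈ Xᶜ),
      ((Qgraph k).induce Xᶜ).connectedComponentMk ⟨_, h⟩ = C.1 := by
    intro C e h
    rw [← hmk C]
    refine componentMk_eq_of_adj _ _ fun hne => ?_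
    obtain ⟨p0, p4, ps⟩ := portVertex_spec (cycleSide (q C).2) e
    exact Qgraph_adj_of_Hgraph_adj k (q C).1
      (Hgraph_adj_of_cycleSide_eq _ _ p0 p4 (h0 C) (h4 C) ps
        fun h => hne (by rw [h]))
  have hhub : ∀ C e, Sum.inr (Sum.inl ((q C).1, portVertex (cycleSide (q C).2) e)) ∉ X →
      Sum.inr (Sum.inl ((q C).1, hubVertex e)) ∈ X := by
    intro C e h
    by_contra h'
    refine C.2 _ h' (hubVertex_eq e) ?_
    rw [← hport C e h]
    exact componentMk_eq_of_adj _ _ fun _ =>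
      (Qgraph_adj_of_Hgraph_adj k (q C).1 (Hgraph_adj_port_hub _ e)).symm
  constructor
  · have := Nat.card_le_card_of_injective
      (fun C : OuterComponent k X => ((q C).1, cycleSide (q C).2))
      (fun C D h => hinj C D (Prod.ext_iff.1 h).1 (Prod.ext_iff.1 h).2)
    simpa [mul_comm] using this
  · let f : OuterComponent k X × Bool → {t : TV k // Sum.inr t ∈ X} := fun p =>
      if h : Sum.inr (Sum.inl ((q p.1).1, portVertex (cycleSide (q p.1).2) p.2)) ∈ X
      then ⟨_, h⟩ else ⟨_, hhub p.1 p.2 h⟩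
    have hf : Function.Injective f := by
      rintro ⟨C, e⟩ ⟨D, e'⟩ h
      simp only [f] at h
      split_ifs at h with h₁ h₂ h₂
      · simp only [Subtype.mk.injEq, Sum.inl.injEq, Prod.mk.injEq] at h
        obtain ⟨hs, he⟩ := portVertex_injective _ _ _ _ h.2
        rw [hinj C D h.1 hs, he]
      · simp only [Subtype.mk.injEq, Sum.inl.injEq, Prod.mk.injEq] at h
        exact absurd h.2 (portVertex_ne_hubVertex _ _ _)
      · simp only [Subtype.mk.injEq, Sum.inl.injEq, Prod.mk.injEq] at h
        exact absurd h.2.symm (portVertex_ne_hubVertex _ _ _)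
      · simp only [Subtype.mk.injEq, Sum.inl.injEq, Prod.mk.injEq] at h
        obtain ⟨hi, he⟩ := h
        obtain rfl := hubVertex_injective _ _ he
        by_cases hs : cycleSide (q C).2 = cycleSide (q D).2
        · rw [hinj C D hi hs]
        · have hCD : C = D := by
            apply Subtype.ext
            rw [← hport C e h₁, ← hport D e h₂]
            refine componentMk_eq_of_adj _ _ fun _ => ?_
            have := Qgraph_adj_of_Hgraph_adj k (q C).1 (Hgraph_adj_port_port _ _ e hs)
            nth_rewrite 2 [hi] at this
            exact this
          rw [hCD]
    have := Nat.card_le_card_of_injective f hf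
    simpa [mul_comm] using this

theorem lP_add_card_le {k : ℕ} {X : Set (QV k)} (hX : ∀ z, Sum.inl z ∈ X) :
    lP k + Nat.card {t : TV k // Sum.inr t ∈ X} ≤ Nat.card X := by
  have := Nat.card_le_card_of_injective
    (Sum.elim (fun z => (⟨Sum.inl z, hX z⟩ : X))
      (fun t : {t : TV k // Sum.inr t ∈ X} => ⟨Sum.inr t.1, t.2⟩))
    (by
      rintro (a | a) (b | b) h
      · simpa using h
      · simp at h
      · simp at h
      · simpa [Subtype.ext_iff] using h)
  simpa [Nat.card_sum] using this

theorem subsingleton_component_of_left_notMem {k : ℕ} {X : Set (QV k)} {z : Fin (lP k)}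
    (hz : Sum.inl z ∉ X) : Subsingleton ((Qgraph k).induce Xᶜ).ConnectedComponent := by
  have key : ∀ C, ((Qgraph k).induce Xᶜ).connectedComponentMk ⟨Sum.inl z, hz⟩ = C := by
    intro C
    induction C using SimpleGraph.ConnectedComponent.ind with
    | h v => exact componentMk_eq_of_adj _ _ (Qgraph_adj_left k z _)
  exact ⟨fun C D => (key C).symm.trans (key D)⟩

theorem card_QV (k : ℕ) : Nat.card (QV k) = 2 * k + 1 := by
  simp only [Nat.card_eq_fintype_card, Fintype.card_sum, Fintype.card_prod, Fintype.card_fin]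
  unfold rP mP lP
  omega

theorem cComp_eq_zero_of_left_notMem {k : ℕ} {X : Set (QV k)} {z : Fin (lP k)}
    (hz : Sum.inl z ∉ X) (hX : Nat.card X ≤ 1) {j : ℕ} (hj : j < k) :
    cComp (Qgraph k) X (2 * j + 1) = 0 := by
  have hsub := subsingleton_component_of_left_notMem hz
  have hadd : Nat.card X + Nat.card (Xᶜ : Set (QV k)) = 2 * k + 1 := by
    rw [← card_QV k]
    exact Set.ncard_add_ncard_compl X
  have : IsEmpty {C : ((Qgraph k).induce Xᶜ).ConnectedComponent //
      Nat.card C.supp = 2 * j + 1} := by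
    refine ⟨fun ⟨C, hC⟩ => ?_⟩
    have hu : C.supp = Set.univ := Set.eq_univ_of_forall fun v => Subsingleton.elim _ _
    rw [hu, Nat.card_univ] at hC
    omega
  exact Nat.card_of_isEmpty

theorem le_linear_bound_iff {k x y : ℝ} (hk : 29 ≤ k) :
    y ≤ ((32 * k + 141) / (72 * k - 78)) * x + (32 * k - 879) / (288 * k - 312) ↔
      y * (288 * k - 312) ≤ (128 * k + 564) * x + (32 * k - 879) := by
  have hD : 0 < 288 * k - 312 := by linarith
  have h1 : (32 * k + 141) / (72 * k - 78) = (128 * k + 564) / (288 * k - 312) := by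
    rw [div_eq_div_iff (by linarith) hD.ne']
    ring
  rw [h1, div_mul_eq_mul_div, ← add_div, le_div_iff₀ hD]

theorem one_le_linear_bound {k x : ℝ} (hk : 29 ≤ k) (hx : 2 ≤ x) :
    1 ≤ ((32 * k + 141) / (72 * k - 78)) * x + (32 * k - 879) / (288 * k - 312) := by
  rw [le_linear_bound_iff hk]
  nlinarith

theorem linear_bound {k q m n x : ℝ} (hk : 29 ≤ k) (hq : 1 ≤ q) (hq' : k - 28 ≤ 17 * q)
    (hm : 8 * m ≤ 2 * k - 2 * q) (hn : 0 ≤ n) (hnm : n ≤ 2 * m) (hx : 2 * q + 2 * n ≤ x) :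
    n + 1 ≤ ((32 * k + 141) / (72 * k - 78)) * x + (32 * k - 879) / (288 * k - 312) := by
  rw [le_linear_bound_iff hk]
  have h2 : (128 * k + 564) * (2 * q + 2 * n) ≤ (128 * k + 564) * x :=
    mul_le_mul_of_nonneg_left hx (by linarith)
  refine le_trans ?_ (add_le_add_left h2 _)
  rcases le_total k 45 with h | h
  · nlinarith [mul_nonneg hn (sub_nonneg.2 h),
      mul_nonneg (sub_nonneg.2 hq) (by linarith : (0 : ℝ) ≤ 256 * k + 1128)]
  · have h3 : (2 * n) * (16 * k - 720) ≤ (k - q) * (16 * k - 720) :=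
      mul_le_mul_of_nonneg_right (by linarith) (by linarith)
    nlinarith [mul_nonneg (sub_nonneg.2 hq') (by linarith : (0 : ℝ) ≤ 16 * k + 24)]

/-- For `k ≥ 29` and every `X ⊆ V(Q)`,
`∑_{0 ≤ j ≤ k-1} c_{2j+1}(Q - X) ≤ ((32k+141)/(72k-78))·|X| + (32k-879)/(288k-312)`. -/
theorem stmt14 (k : ℕ) (hk : 29 ≤ k) (X : Set (QV k)) :
    (∑ j ∈ Finset.range k, (cComp (Qgraph k) X (2 * j + 1) : ℝ)) ≤
      ((32 * (k : ℝ) + 141) / (72 * (k : ℝ) - 78)) * Nat.card X +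
        (32 * (k : ℝ) - 879) / (288 * (k : ℝ) - 312) := by
  have hk' : (29 : ℝ) ≤ k := by exact_mod_cast hk
  have hsum := sum_cComp_le_card (Qgraph k) X k
  set q := (k - 12) / 17 with hq_def
  have hq : (1 : ℝ) ≤ q := by
    have : 1 ≤ q := by omega
    exact_mod_cast this
  have hq' : (k : ℝ) - 28 ≤ 17 * q := by
    have : k ≤ 17 * q + 28 := by omega
    have : (k : ℝ) ≤ 17 * q + 28 := by exact_mod_cast this
    linarith
  have hm : 8 * (mP k : ℝ) ≤ 2 * k - 2 * q := by
    have : 8 * mP k + 2 * q ≤ 2 * k := by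
      unfold mP lP
      omega
    have : 8 * (mP k : ℝ) + 2 * q ≤ 2 * k := by exact_mod_cast this
    linarith
  by_cases hX : ∀ z, Sum.inl z ∈ X
  · obtain ⟨h₁, h₂⟩ := card_outerComponent_le hX
    have h₃ := lP_add_card_le hX
    have h₄ := hsum.trans (card_component_le_card_outerComponent k X)
    have hl : lP k = 2 * q := rfl
    refine le_trans (by exact_mod_cast h₄) (linear_bound hk' hq hq' hm (Nat.cast_nonneg _)
      (by exact_mod_cast h₁) ?_)
    have : 2 * q + 2 * Nat.card (OuterComponent k X) ≤ Nat.card X := by omega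
    exact_mod_cast this
  · push Not at hX
    obtain ⟨z, hz⟩ := hX
    rcases le_or_gt (Nat.card X) 1 with h | h
    · rw [Finset.sum_eq_zero fun j hj => by
        rw [cComp_eq_zero_of_left_notMem hz h (Finset.mem_range.1 hj), Nat.cast_zero]]
      have : 0 ≤ (32 * (k : ℝ) + 141) / (72 * (k : ℝ) - 78) :=
        div_nonneg (by linarith) (by linarith)
      have : 0 ≤ (32 * (k : ℝ) - 879) / (288 * (k : ℝ) - 312) :=
        div_nonneg (by linarith) (by linarith)
      positivity
    · have hsub := subsingleton_component_of_left_notMem hz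
      have h₄ := hsum.trans (Finite.card_le_one_iff_subsingleton.2 hsub)
      have hX2 : (2 : ℝ) ≤ Nat.card X := by exact_mod_cast h
      exact le_trans (by exact_mod_cast h₄) (one_le_linear_bound hk' hX2)
end
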